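/- arXiv:2509.00273 — 2 statements merged into one kernel-verified Lean document; each statement's English description precedes it below -/
import Mathlib

section
/- Let ℓ be a prime with ℓ ≡ 3 (mod 4) and let p be a prime with p ≡ 1 (mod 4) (so p ≠ ℓ). Then for every positive integer n, the curve H_ℓ is not maximal over 𝔽_{p^{2n}}; that is, for q = p^n one has #{(x,y) ∈ 𝔽_{q²} × 𝔽_{q²} : y² = φ_ℓ(x)} ≠ q² + (ℓ−1)q. -/
open Polynomial

/-- Number of affine points (x,y) ∈ F × F with y² = φ_d(x), where φ_d is the
d-th Chebyshev (Dickson first kind, parameter 1) polynomial over F. -/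
noncomputable def chebAffineCount (F : Type) [Field F] (d : ℕ) : ℕ :=
  Nat.card {xy : F × F // xy.2 ^ 2 = (dickson 1 (1 : F) d).eval xy.1}

/-- The hyperelliptic curve H_d : y² = φ_d(x) is maximal over the field with q² elements:
its affine point count attains q² + (d-1)q (Hasse–Weil bound minus the point at infinity). -/
def chebMaximal (d q : ℕ) : Prop :=
  ∀ (F : Type) [Field F] [Fintype F], Fintype.card F = q ^ 2 →
    chebAffineCount F d = q ^ 2 + (d - 1) * q



lemma digit_aux (p : ℕ) (hp : 2 ≤ p) : ∀ (f a : ℕ), a < p ^ f →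
    (p - 1) * ∑ i ∈ Finset.range f, a / p ^ (i + 1) + (p.digits a).sum = a := by
  intro f
  induction f with
  | zero => intro a ha; simp at ha; simp [ha]
  | succ f ih =>
    intro a ha
    rcases Nat.eq_zero_or_pos a with rfl | h0
    · simp
    have h1 := ih (a / p) (by rw [Nat.div_lt_iff_lt_mul (by omega)]; rwa [pow_succ] at ha)
    rw [Nat.digits_def' (by omega) h0, Finset.sum_range_succ']
    have h2 : ∀ i, a / p ^ (i + 1 + 1) = a / p / p ^ (i + 1) := by
      intro i; rw [Nat.div_div_eq_div_mul, ← pow_succ']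
    simp only [h2, List.sum_cons, zero_add, pow_one, mul_add]
    have h3 := Nat.div_add_mod a p
    have h4 : (p - 1) * (a / p) + a / p = p * (a / p) := by
      obtain ⟨c, rfl⟩ : ∃ c, p = c + 1 := ⟨p - 1, by omega⟩
      simp [add_mul]
    omega

lemma digit_formula (p f a : ℕ) (hp : 2 ≤ p) (ha : a < p ^ f - 1) :
    (p - 1) * ∑ i ∈ Finset.range f, (p ^ i * a % (p ^ f - 1)) =
      (p ^ f - 1) * (p.digits a).sum := by
  have h1 : ∀ j ∈ Finset.range f,
      p ^ (f - 1 - j) * a % (p ^ f - 1) + (p ^ f - 1) * (a / p ^ (j + 1)) = p ^ (f - 1 - j) * a := by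
    intro j hj
    have hj : j < f := by simpa using hj
    have hQ : p ^ f = p ^ (f - 1 - j) * p ^ (j + 1) := by
      rw [← pow_add]; congr 1; omega
    have hpos : 0 < p ^ (j + 1) := by positivity
    have hpos2 : 0 < p ^ (f - 1 - j) := by positivity
    have hQ0 : 0 < p ^ f := by positivity
    set h := a / p ^ (j + 1) with hh
    set r := a % p ^ (j + 1) with hr
    have hdiv : p ^ (j + 1) * h + r = a := Nat.div_add_mod _ _
    have hrlt : r < p ^ (j + 1) := Nat.mod_lt _ hpos
    have hhlt : h < p ^ (f - 1 - j) := by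
      rw [hh, Nat.div_lt_iff_lt_mul hpos, ← hQ]; omega
    set M := p ^ (f - 1 - j) with hM
    set N := p ^ (j + 1) with hN
    have e1 : M * a = (h + M * r) + (p ^ f - 1) * h := by
      have : (p ^ f - 1) * h + h = p ^ f * h := by
        rw [Nat.sub_mul, one_mul, Nat.sub_add_cancel (Nat.le_mul_of_pos_left _ hQ0)]
      rw [← hdiv]
      calc M * (N * h + r) = p ^ f * h + M * r := by rw [hQ]; ring
        _ = _ := by rw [← this]; ring
    have hlt : h + M * r < p ^ f - 1 := by
      by_contra hcon
      push Not at hcon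
      have h1 : M * r ≤ M * (N - 1) := Nat.mul_le_mul_left _ (by omega)
      have h2 : M * (N - 1) + M = p ^ f := by
        rw [hQ]; nth_rewrite 2 [← mul_one M]; rw [← mul_add]; congr 1; omega
      have hh' : h = M - 1 := by omega
      have hr' : M * r = M * (N - 1) := by omega
      have hr'' : r = N - 1 := Nat.eq_of_mul_eq_mul_left hpos2 hr'
      have : a + 1 = p ^ f := by
        rw [← hdiv, hh', hr'', hQ, mul_comm M N]
        obtain ⟨x, hx⟩ : ∃ x, M = x + 1 := ⟨M - 1, by omega⟩
        rw [hx]; simp only [Nat.add_sub_cancel]; rw [mul_add]; omega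
      omega
    rw [e1, Nat.add_mul_mod_self_left, Nat.mod_eq_of_lt hlt]
  have h2 := Finset.sum_congr rfl h1
  rw [Finset.sum_add_distrib, ← Finset.mul_sum, Finset.sum_range_reflect (fun i => p ^ i * a % (p ^ f - 1)),
    Finset.sum_range_reflect (fun i => p ^ i * a), ← Finset.sum_mul] at h2
  have h3 : (p - 1) * ∑ i ∈ Finset.range f, p ^ i = p ^ f - 1 := by
    rw [mul_comm]; exact geom_sum_mul_of_one_le (by omega) f
  have hlog : a < p ^ f := by omega
  have h4 : (p - 1) * ∑ i ∈ Finset.range f, a / p ^ (i + 1) = a - (p.digits a).sum := by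
    have := digit_aux p hp f a hlog
    omega
  have h5 : (p.digits a).sum ≤ a := Nat.digit_sum_le p a
  have h6 : (p - 1) * ∑ i ∈ Finset.range f, (p ^ i * a % (p ^ f - 1)) + (p ^ f - 1) * (a - (p.digits a).sum) =
     (p ^ f - 1) * a := by
    rw [← h4, ← h3]
    rw [h3]
    calc _ = (p - 1) * (∑ i ∈ Finset.range f, (p ^ i * a % (p ^ f - 1)) + (p ^ f - 1) * ∑ i ∈ Finset.range f, a / p ^ (i + 1)) := by ring
      _ = _ := by rw [h2, ← mul_assoc, h3]
  rw [Nat.mul_sub] at h6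
  have : (p ^ f - 1) * (p.digits a).sum ≤ (p ^ f - 1) * a := Nat.mul_le_mul_left _ h5
  omega

lemma sum_class (l r : ℕ) (hr : r < 4) :
    ∑ k ∈ (Finset.range (4 * l)).filter (fun k => k % 4 = r), k = ∑ j ∈ Finset.range l, (4 * j + r) := by
  symm
  apply Finset.sum_bij (fun j _ => 4 * j + r)
  · intro j hj; simp at hj ⊢; omega
  · intro a _ b _ h; omega
  · intro k hk; simp at hk; exact ⟨k / 4, by simp; omega, by omega⟩
  · intros; rfl

lemma combin (l p f m : ℕ) (hl : l.Prime) (hl4 : l % 4 = 3) (hp : p.Prime) (hp4 : p % 4 = 1)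
    (hf : 0 < f) (hm : 4 * l * m = p ^ f - 1)
    (hs : ∀ k < 4 * l, k % 4 = 1 → ¬ l ∣ k →
      (p.digits (k * m)).sum = (p.digits ((k + 2 * l) % (4 * l) * m)).sum) : False := by
  have hl0 : 0 < l := hl.pos
  have hp2 := hp.two_le
  have hQ : p ≤ p ^ f := Nat.le_self_pow hf.ne' p
  have hm0 : 0 < m := by
    rcases Nat.eq_zero_or_pos m with h | h
    · subst h; omega
    · exact h
  have hpl : l.Coprime p := by
    rw [Nat.coprime_primes hl hp]; rintro rfl; omega
  have h4p : Nat.Coprime 4 p := by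
    have : Nat.Coprime 2 p := by rw [Nat.coprime_primes Nat.prime_two hp]; rintro rfl; omega
    exact Nat.Coprime.pow_left 2 this
  have h4lp : ∀ i, Nat.Coprime (4 * l) (p ^ i) := fun i =>
    Nat.Coprime.pow_right i (Nat.Coprime.mul_left h4p hpl)
  set K : ℕ → Finset ℕ := fun r => (Finset.range (4 * l)).filter (fun k => k % 4 = r ∧ ¬ l ∣ k) with hK
  have hmod4 : ∀ x, x % (4 * l) % 4 = x % 4 := fun x => Nat.mod_mod_of_dvd _ (dvd_mul_right _ _)
  have hmodl : ∀ x, l ∣ x % (4 * l) ↔ l ∣ x := fun x => Nat.dvd_mod_iff (dvd_mul_left _ _)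
  have hperm : ∀ r i, ∑ k ∈ K r, (p ^ i * k % (4 * l)) = ∑ k ∈ K r, k := by
    intro r i
    have hmaps : Set.MapsTo (fun k => p ^ i * k % (4 * l)) (K r : Set ℕ) (K r : Set ℕ) := by
      intro k hk
      simp only [hK, Finset.coe_filter, Finset.mem_range, Set.mem_ofPred_eq] at hk ⊢
      refine ⟨Nat.mod_lt _ (by omega), ?_, ?_⟩
      · rw [hmod4, Nat.mul_mod, Nat.pow_mod, hp4]; simp; omega
      · rw [hmodl, Nat.Coprime.dvd_mul_left (hpl.pow_right i)]; exact hk.2.2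
    have hinj : Set.InjOn (fun k => p ^ i * k % (4 * l)) (K r : Set ℕ) := by
      intro a ha b hb hab
      simp only [hK, Finset.coe_filter, Finset.mem_range, Set.mem_ofPred_eq] at ha hb
      have : a ≡ b [MOD 4 * l] := Nat.ModEq.cancel_left_of_coprime (h4lp i) hab
      exact Nat.ModEq.eq_of_lt_of_lt this ha.1 hb.1
    have himg : (K r).image (fun k => p ^ i * k % (4 * l)) = K r := by
      apply Finset.eq_of_subset_of_card_le
      · intro x hx
        obtain ⟨k, hk, rfl⟩ := Finset.mem_image.1 hx
        exact hmaps hk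
      · rw [Finset.card_image_of_injOn hinj]
    conv_rhs => rw [← himg]
    rw [Finset.sum_image hinj]
  have hS : ∀ r, 4 * l * ∑ k ∈ K r, (p.digits (k * m)).sum = (p - 1) * (f * ∑ k ∈ K r, k) := by
    intro r
    have : ∀ k ∈ K r, 4 * l * (p.digits (k * m)).sum = (p - 1) * ∑ i ∈ Finset.range f, (p ^ i * k % (4 * l)) := by
      intro k hk
      simp only [hK, Finset.mem_filter, Finset.mem_range] at hk
      have := digit_formula p f (k * m) hp2 (by rw [← hm]; exact Nat.mul_lt_mul_of_pos_right hk.1 hm0)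
      simp only [← hm, ← mul_assoc] at this
      simp only [Nat.mul_mod_mul_right] at this
      rw [← Finset.sum_mul, ← mul_assoc] at this
      apply Nat.eq_of_mul_eq_mul_right hm0
      rw [this]; ring
    rw [Finset.mul_sum, Finset.sum_congr rfl this, ← Finset.mul_sum, Finset.sum_comm]
    simp [hperm]
  have hbij : ∑ k ∈ K 1, (p.digits (k * m)).sum = ∑ k ∈ K 3, (p.digits (k * m)).sum := by
    have inv : ∀ k < 4 * l, ((k + 2 * l) % (4 * l) + 2 * l) % (4 * l) = k := by
      intro k hk
      rcases lt_or_ge k (2 * l) with h | h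
      · rw [Nat.mod_eq_of_lt (by omega : k + 2 * l < 4 * l)]
        rw [show k + 2 * l + 2 * l = k + 4 * l by omega, Nat.add_mod_right, Nat.mod_eq_of_lt hk]
      · rw [show k + 2 * l = (k - 2 * l) + 4 * l by omega, Nat.add_mod_right, Nat.mod_eq_of_lt (by omega : k - 2 * l < 4 * l)]
        rw [Nat.mod_eq_of_lt (by omega)]; omega
    have hd : ∀ k, l ∣ k + 2 * l ↔ l ∣ k := fun k => (Nat.dvd_add_iff_left (dvd_mul_left _ _)).symm
    refine Finset.sum_bij' (fun k _ => (k + 2 * l) % (4 * l)) (fun k _ => (k + 2 * l) % (4 * l)) ?_ ?_ ?_ ?_ ?_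
    · intro k hk
      simp only [hK, Finset.mem_filter, Finset.mem_range] at hk ⊢
      refine ⟨Nat.mod_lt _ (by omega), by rw [hmod4]; omega, by rw [hmodl, hd]; exact hk.2.2⟩
    · intro k hk
      simp only [hK, Finset.mem_filter, Finset.mem_range] at hk ⊢
      refine ⟨Nat.mod_lt _ (by omega), by rw [hmod4]; omega, by rw [hmodl, hd]; exact hk.2.2⟩
    · intro k hk
      simp only [hK, Finset.mem_filter, Finset.mem_range] at hk
      exact inv k hk.1
    · intro k hk
      simp only [hK, Finset.mem_filter, Finset.mem_range] at hk
      exact inv k hk.1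
    · intro k hk
      simp only [hK, Finset.mem_filter, Finset.mem_range] at hk
      exact hs k hk.1 hk.2.1 hk.2.2
  have heq : ∑ k ∈ K 1, k = ∑ k ∈ K 3, k := by
    have h1 := hS 1
    rw [hbij, hS 3] at h1
    have := Nat.eq_of_mul_eq_mul_left (by omega : 0 < p - 1) h1
    exact (Nat.eq_of_mul_eq_mul_left hf this).symm
  have hsplit : ∀ r c, c < 4 → (c * l) % 4 = r → (∀ d < 4, (d * l) % 4 = r → d = c) →
      ∑ k ∈ K r, k + c * l = ∑ k ∈ (Finset.range (4 * l)).filter (fun k => k % 4 = r), k := by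
    intro r c hc hcr huniq
    have hins : (Finset.range (4 * l)).filter (fun k => k % 4 = r) = insert (c * l) (K r) := by
      ext k
      simp only [hK, Finset.mem_filter, Finset.mem_range, Finset.mem_insert]
      constructor
      · rintro ⟨h1, h2⟩
        by_cases hdk : l ∣ k
        · left
          obtain ⟨d, rfl⟩ := hdk
          have : d < 4 := by
            rw [mul_comm 4 l] at h1; exact lt_of_mul_lt_mul_left h1 (Nat.zero_le _)
          rw [huniq d this (by rw [mul_comm]; exact h2), mul_comm]
        · right; exact ⟨h1, h2, hdk⟩
      · rintro (rfl | ⟨h1, h2, h3⟩)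
        · exact ⟨Nat.mul_lt_mul_of_pos_right hc hl0, hcr⟩
        · exact ⟨h1, h2⟩
    rw [hins, Finset.sum_insert, add_comm]
    simp [hK]
  have s1 := hsplit 1 3 (by omega) (by omega) (by intro d hd h; interval_cases d <;> omega)
  have s3 := hsplit 3 1 (by omega) (by omega) (by intro d hd h; interval_cases d <;> omega)
  rw [sum_class _ _ (by omega), Finset.sum_add_distrib] at s1 s3
  simp at s1 s3
  omega



lemma exists_val (p : ℕ) [Fact p.Prime] : ∃ A : ValuationSubring ℂ, A.valuation (p : ℂ) < 1 := by
  set R : Subring ℂ := (Int.castRingHom ℂ).range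
  set I : Ideal R := Ideal.span {(p : R)}
  have hI : I ≠ ⊤ := by
    intro h
    rw [Ideal.eq_top_iff_one, Ideal.mem_span_singleton] at h
    obtain ⟨⟨c, z, hz⟩, hc⟩ := h
    have h2 := congrArg (Subtype.val) hc
    simp at h2 hz
    rw [← hz] at h2
    have h3 : (1 : ℤ) = p * z := by exact_mod_cast h2
    have h4 : (p : ℤ) ∣ 1 := ⟨z, h3⟩
    have := (Fact.out : p.Prime).one_lt
    have := Int.le_of_dvd one_pos h4
    omega
  obtain ⟨B, h1, h2⟩ := Ideal.image_subset_nonunits_valuationSubring I hI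
  refine ⟨B, ?_⟩
  have : (p : ℂ) ∈ B.nonunits := h2 ⟨(p : R), Ideal.mem_span_singleton_self _, by simp⟩
  exact this

lemma mem_of_pow_one (A : ValuationSubring ℂ) {z : ℂ} {n : ℕ} (hn : n ≠ 0) (h : z ^ n = 1) :
    A.valuation z = 1 := by
  have : A.valuation z ^ n = 1 := by rw [← map_pow, h, map_one]
  exact (pow_eq_one_iff.1 this).resolve_right hn

lemma exists_teich (F : Type) [Field F] [Fintype F] (p : ℕ) [Fact p.Prime] [CharP F p] :
    ∃ (A : ValuationSubring ℂ) (ω : MulChar F ℂ) (hω : ∀ x, ω x ∈ A)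
      (ι : F →+* IsLocalRing.ResidueField A), A.valuation (p : ℂ) < 1 ∧
      ∀ x, IsLocalRing.residue A ⟨ω x, hω x⟩ = ι x := by
  classical
  obtain ⟨A, hA⟩ := exists_val p
  set k := IsLocalRing.ResidueField A
  set Q := Fintype.card F with hQ
  have hQ1 : 1 < Q := Fintype.one_lt_card
  have hpk : (p : k) = 0 := by
    have : ((p : ℕ) : A) ∈ IsLocalRing.maximalIdeal A := by
      rw [ValuationSubring.valuation_lt_one_iff]; simpa using hA
    have h2 := (IsLocalRing.residue_eq_zero_iff ((p : ℕ) : A)).2 this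
    simpa using h2
  have : CharP k p := by
    have := CharP.charP_iff_prime_eq_zero (R := k) (Fact.out : p.Prime)
    exact this.2 hpk
  let : Algebra (ZMod p) k := ZMod.algebra k p
  let : Algebra (ZMod p) F := ZMod.algebra F p
  obtain ⟨z, hz⟩ : ∃ z : ℂ, IsPrimitiveRoot z (Q - 1) :=
    ⟨_, Complex.isPrimitiveRoot_exp (Q - 1) (by omega)⟩
  have hzA : z ∈ A := by
    rw [← ValuationSubring.valuation_le_one_iff]
    exact (mem_of_pow_one A (by omega) hz.pow_eq_one).le
  have hzA' : IsPrimitiveRoot (⟨z, hzA⟩ : A) (Q - 1) := by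
    apply IsPrimitiveRoot.of_map_of_injective (f := A.subtype) (by simpa using hz) A.subtype_injective
  have hprod := X_pow_sub_one_eq_prod (by omega) hzA'
  have hprodk : (X ^ (Q - 1) - 1 : k[X]) =
      ∏ ζ ∈ nthRootsFinset (Q - 1) (1 : A), (X - C (IsLocalRing.residue A ζ)) := by
    have := congrArg (Polynomial.map (IsLocalRing.residue A)) hprod
    simpa [Polynomial.map_prod] using this
  have hsplit : Splits (X ^ Q - X : k[X]) := by
    have : (X ^ Q - X : k[X]) = X * (X ^ (Q - 1) - 1) := by
      rw [mul_sub, ← pow_succ', mul_one]; congr 2; omega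
    rw [this, hprodk]
    exact Splits.mul Splits.X (Splits.prod fun i _ => Splits.X_sub_C _)
  have : IsSplittingField (ZMod p) F (X ^ Q - X) := FiniteField.isSplittingField_sub F (ZMod p)
  let ι' : F →ₐ[ZMod p] k := IsSplittingField.lift F (X ^ Q - X) (by simpa using hsplit)
  let ι : F →+* k := ι'.toRingHom
  obtain ⟨g, hg⟩ := IsCyclic.exists_generator (α := Fˣ)
  have hroot : ∃ ζ : A, ζ ^ (Q - 1) = 1 ∧ IsLocalRing.residue A ζ = ι g := by
    have h1 : (X ^ (Q - 1) - 1 : k[X]).eval (ι g) = 0 := by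
      simp only [eval_sub, eval_pow, eval_X, eval_one]
      rw [← map_pow, FiniteField.pow_card_sub_one_eq_one _ g.ne_zero]; simp
    rw [hprodk, eval_prod, Finset.prod_eq_zero_iff] at h1
    obtain ⟨ζ, h2, h3⟩ := h1
    refine ⟨ζ, (mem_nthRootsFinset (by omega) _).1 h2, ?_⟩
    simp only [eval_sub, eval_X, eval_C] at h3
    exact (sub_eq_zero.1 h3).symm
  obtain ⟨ζ, hζ1, hζ2⟩ := hroot
  have hζ1' : (ζ : ℂ) ^ (Q - 1) = 1 := by exact_mod_cast congrArg Subtype.val hζ1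
  let u : ℂˣ := Units.ofPowEqOne (ζ : ℂ) (Q - 1) hζ1' (by omega)
  have hu : u ∈ rootsOfUnity (Fintype.card Fˣ) ℂ := by
    rw [mem_rootsOfUnity, Fintype.card_units]
    exact Units.pow_ofPowEqOne _ _
  let ω := MulChar.ofRootOfUnity hu hg
  have hωg : ω g = ζ := by
    rw [MulChar.ofRootOfUnity_spec]; rfl
  have hpow : ∀ x : Fˣ, ∃ n : ℕ, x = g ^ n := fun x => by
    obtain ⟨n, hn⟩ := (mem_powers_iff_mem_zpowers).2 (hg x)
    exact ⟨n, hn.symm⟩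
  have hω0 : ω 0 = 0 := MulChar.map_zero _
  have hωn : ∀ n : ℕ, ω ((g ^ n : Fˣ) : F) = (ζ : ℂ) ^ n := by
    intro n; rw [Units.val_pow_eq_pow_val, map_pow, hωg]
  have hω : ∀ x, ω x ∈ A := by
    intro x
    by_cases hx : x = 0
    · rw [hx, hω0]; exact A.zero_mem
    · obtain ⟨n, hn⟩ := hpow (Units.mk0 x hx)
      have : x = ((g ^ n : Fˣ) : F) := by rw [← hn]; rfl
      rw [this, hωn]; exact pow_mem ζ.2 n
  refine ⟨A, ω, hω, ι, hA, ?_⟩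
  intro x
  by_cases hx : x = 0
  · subst hx
    have : (⟨ω 0, hω 0⟩ : A) = 0 := Subtype.ext hω0
    rw [this]; simp
  · obtain ⟨n, hn⟩ := hpow (Units.mk0 x hx)
    have : x = ((g ^ n : Fˣ) : F) := by rw [← hn]; rfl
    have h2 : (⟨ω x, hω x⟩ : A) = ζ ^ n := by
      apply Subtype.ext
      rw [this]
      simp only [hωn]; simp
    rw [h2, map_pow, hζ2, this]; simp

lemma exists_addChar (F : Type) [Field F] [Fintype F] (p : ℕ) [Fact p.Prime] [CharP F p] :
    ∃ ψ : AddChar F ℂ, ψ.IsPrimitive ∧ ∀ x, ψ (x ^ p) = ψ x := by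
  let : Algebra (ZMod p) F := ZMod.algebra F p
  have : NeZero p := ⟨(Fact.out : p.Prime).ne_zero⟩
  have hz := Complex.isPrimitiveRoot_exp p (NeZero.ne p)
  let ψ₀ := AddChar.zmodChar p hz.pow_eq_one
  have hψ₀ : ψ₀.IsPrimitive := AddChar.zmodChar_primitive_of_primitive_root p hz
  let ψ : AddChar F ℂ := ψ₀.compAddMonoidHom (Algebra.trace (ZMod p) F).toAddMonoidHom
  refine ⟨ψ, AddChar.IsPrimitive.of_ne_one ?_, ?_⟩
  · intro h
    obtain ⟨a, ha⟩ := Algebra.trace_surjective (ZMod p) F 1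
    have h1 : ψ a = 1 := by rw [h]; rfl
    have h2 : ψ₀ 1 = 1 := by rw [← ha]; exact h1
    rw [hψ₀.zmod_char_eq_one_iff] at h2
    exact one_ne_zero h2
  · intro x
    have : Algebra.trace (ZMod p) F (x ^ p) = Algebra.trace (ZMod p) F x := by
      have := Algebra.trace_eq_of_algEquiv (FiniteField.frobeniusAlgEquiv (ZMod p) F p) x
      simpa using this
    show ψ₀ (Algebra.trace (ZMod p) F (x ^ p)) = ψ₀ (Algebra.trace (ZMod p) F x)
    rw [this]

lemma sum_inv_aux (F : Type) [Field F] [Fintype F] (a : ℕ) (ha : 1 ≤ a)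
    (haQ : a + 1 < Fintype.card F - 1) :
    ∑ x : F, (x⁻¹) ^ a * (1 - x)⁻¹ = -((a + 1 : ℕ) : F) := by
  classical
  have hsum : ∀ i, i < Fintype.card F - 1 → ∑ x : F, x ^ i = 0 := fun i hi =>
    FiniteField.sum_pow_lt_card_sub_one F i hi
  have h1 : ∑ x : F, (x⁻¹) ^ a * (1 - x)⁻¹ = ∑ x : F, x ^ (a + 1) * (x - 1)⁻¹ := by
    rw [← Equiv.sum_comp (Equiv.inv F)]
    apply Finset.sum_congr rfl
    intro x _
    simp only [Equiv.inv_apply, inv_inv]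
    by_cases hx : x = 0
    · subst hx; simp; omega
    · have : (1 - x⁻¹) = (x - 1) * x⁻¹ := by field_simp
      rw [this, mul_inv, inv_inv, pow_succ]; ring
  have h2 : ∀ x : F, x ^ (a + 1) * (x - 1)⁻¹ =
      (∑ i ∈ Finset.range (a + 1), x ^ i - if x = 1 then ((a + 1 : ℕ) : F) else 0) + (x - 1)⁻¹ := by
    intro x
    split_ifs with hx
    · subst hx; simp
    · have hx' : x - 1 ≠ 0 := sub_ne_zero.2 hx
      have := geom_sum_mul x (a + 1)
      field_simp
      rw [sub_zero, mul_comm (x - 1), this]; ring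
  have h3 : ∑ x : F, (x - 1)⁻¹ = 0 := by
    have e1 := Equiv.sum_comp (Equiv.subRight (1 : F)) (fun y => y⁻¹)
    have e2 := Equiv.sum_comp (Equiv.inv F) (fun y => y)
    have := hsum 1 (by omega)
    simp only [Equiv.subRight_apply] at e1
    simp only [Equiv.inv_apply] at e2
    rw [e1, e2]
    simpa using this
  rw [h1, Finset.sum_congr rfl (fun x _ => h2 x), Finset.sum_add_distrib, h3, Finset.sum_sub_distrib,
    Finset.sum_comm, Finset.sum_eq_zero (fun i hi => hsum i (by simp at hi; omega))]
  simp

lemma stick (F : Type) [Field F] [Fintype F] (p : ℕ) [Fact p.Prime] [CharP F p]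
    (A : ValuationSubring ℂ) (T : MulChar F ℂ) (hT : ∀ x, T x ∈ A)
    (ι : F →+* IsLocalRing.ResidueField A)
    (hι : ∀ x, IsLocalRing.residue A ⟨T x, hT x⟩ = ι x⁻¹)
    (hord : ∀ a, 0 < a → a < Fintype.card F - 1 → T ^ a ≠ 1)
    (ψ : AddChar F ℂ) (hψ : ψ.IsPrimitive) (hψp : ∀ x, ψ (x ^ p) = ψ x) (a : ℕ)
    (ha : a < Fintype.card F - 1) :
    A.valuation (gaussSum (T ^ a) ψ) = A.valuation (gaussSum T ψ) ^ (p.digits a).sum := by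
  classical
  have hp := (Fact.out : p.Prime)
  have hψ1 : ψ ≠ 1 := by
    rintro rfl
    apply hψ one_ne_zero
    ext x; simp
  induction a using Nat.strong_induction_on with
  | _ a ih =>
    rcases Nat.eq_zero_or_pos a with rfl | h0
    · rw [pow_zero, gaussSum_one_left hψ1]; simp [Valuation.map_neg]
    have hdig := Nat.digits_def' hp.one_lt h0
    by_cases hpa : p ∣ a
    · obtain ⟨b, rfl⟩ := hpa
      have hb : 0 < b := Nat.pos_of_mul_pos_left h0
      have hlt : b < p * b := by nlinarith [hp.two_le]
      have hG : gaussSum (T ^ (p * b)) ψ = gaussSum (T ^ b) ψ := by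
        have hbij : Function.Bijective (fun x : F => x ^ p) := by
          have := frobenius_inj F p
          exact (Finite.injective_iff_bijective).1 this
        unfold gaussSum
        rw [← Function.Bijective.sum_comp hbij (fun x => (T ^ b) x * ψ x)]
        apply Finset.sum_congr rfl
        intro x _
        rw [hψp, map_pow, ← MulChar.pow_apply' _ hp.ne_zero, ← pow_mul, mul_comm b p]
      rw [hG, ih b hlt (by omega), hdig]
      simp [Nat.mul_div_cancel_left _ hp.pos]
    · obtain ⟨b, rfl⟩ : ∃ b, a = b + 1 := ⟨a - 1, by omega⟩
      have hs : (p.digits (b + 1)).sum = (p.digits b).sum + 1 := by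
        rw [hdig]
        have hm : (b + 1) % p ≠ 0 := fun h => hpa (Nat.dvd_of_mod_eq_zero h)
        have hb1 := Nat.div_add_mod (b + 1) p
        have hlt := Nat.mod_lt (b + 1) hp.pos
        have hbe : b = p * ((b + 1) / p) + ((b + 1) % p - 1) := by omega
        have hdm : ∀ b X r, r < p → b = p * X + r → b / p = X ∧ b % p = r := by
          rintro _ X r hr rfl
          rw [Nat.mul_add_div hp.pos, Nat.div_eq_of_lt hr, Nat.mul_add_mod, Nat.mod_eq_of_lt hr]
          simp
        have e1 : b / p = (b + 1) / p := by
          exact (hdm b _ _ (by omega) hbe).1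
        have e2 : b % p = (b + 1) % p - 1 := by
          exact (hdm b _ _ (by omega) hbe).2
        rcases Nat.eq_zero_or_pos b with hb0 | hb0
        · subst hb0; simp [Nat.mod_eq_of_lt hp.one_lt, Nat.div_eq_of_lt hp.one_lt]
        rw [Nat.digits_def' hp.one_lt hb0, e1, e2]
        simp only [List.sum_cons]; omega
      have hne : T ^ b * T ≠ 1 := by rw [← pow_succ]; exact hord _ h0 ha
      have hJ := jacobiSum_mul_nontrivial hne ψ
      have hvJ : A.valuation (jacobiSum (T ^ b) T) = 1 := by
        rcases Nat.eq_zero_or_pos b with hb0 | hb0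
        · subst hb0
          rw [pow_zero, jacobiSum_one_nontrivial (by simpa using hne)]; simp [Valuation.map_neg]
        · let y : A := ∑ x : F, (⟨T x, hT x⟩ : A) ^ b * ⟨T (1 - x), hT _⟩
          have hy : (y : ℂ) = jacobiSum (T ^ b) T := by
            simp only [y, jacobiSum]
            push_cast
            apply Finset.sum_congr rfl
            intro x _
            rw [MulChar.pow_apply' _ hb0.ne']
          have hres : IsLocalRing.residue A y = ι (-((b + 1 : ℕ) : F)) := by
            rw [← sum_inv_aux F b hb0 ha]
            simp only [y, map_sum, map_mul, map_pow, hι]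
          have hne0 : IsLocalRing.residue A y ≠ 0 := by
            rw [hres, Ne, map_eq_zero, neg_eq_zero, CharP.cast_eq_zero_iff F p]; exact hpa
          have hu : IsUnit y := (IsLocalRing.residue_ne_zero_iff_isUnit y).1 hne0
          rw [← hy]
          exact (ValuationSubring.valuation_eq_one_iff A y).1 hu
      rw [hs, pow_succ T, pow_succ (A.valuation _), ← ih b (by omega) (by omega), ← map_mul, ← hJ, map_mul, hvJ, mul_one]

/-- main consequence -/
lemma val_main (F : Type) [Field F] [Fintype F] (p n : ℕ) [Fact p.Prime] [CharP F p]
    (hcard : Fintype.card F = (p ^ n) ^ 2) (hn : 0 < n) :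
    ∃ T : MulChar F ℂ, (∀ a, T ^ a = 1 ↔ Fintype.card F - 1 ∣ a) ∧
      ∀ (χ : MulChar F ℂ), χ ≠ 1 → χ.IsQuadratic → ∀ a c, a < Fintype.card F - 1 →
        c < Fintype.card F - 1 → 0 < c → T ^ a * χ = T ^ c → 
        jacobiSum (T ^ a) χ = (p ^ n : ℕ) → (p.digits a).sum = (p.digits c).sum := by
  classical
  have hp := (Fact.out : p.Prime)
  obtain ⟨A, ω, hω, ι, hA, hι⟩ := exists_teich F p
  obtain ⟨ψ, hψ, hψp⟩ := exists_addChar F p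
  have hT : ∀ x, ω⁻¹ x ∈ A := fun x => by rw [MulChar.inv_apply']; exact hω _
  have hTι : ∀ x, IsLocalRing.residue A ⟨ω⁻¹ x, hT x⟩ = ι x⁻¹ := by
    intro x
    rw [← hι]; congr 2; rw [MulChar.inv_apply']
  have hord : ∀ a, (ω⁻¹) ^ a = 1 ↔ Fintype.card F - 1 ∣ a := by
    intro a
    rw [← FiniteField.forall_pow_eq_one_iff]
    constructor
    · intro h x
      have h1 : (ω⁻¹) ^ a * ω ^ a = 1 := by rw [← mul_pow]; simp
      rw [h, one_mul] at h1
      have h2 : ω (x : F) ^ a = 1 := by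
        rw [← MulChar.pow_apply_coe, h1, MulChar.one_apply_coe]
      have h3 : (⟨ω x, hω x⟩ : A) ^ a = 1 := Subtype.ext (by simpa using h2)
      have h4 := congrArg (IsLocalRing.residue A) h3
      rw [map_pow, hι, map_one, ← map_pow, ← map_one ι] at h4
      have := ι.injective h4
      exact Units.ext (by simpa using this)
    · intro h
      ext x
      rw [MulChar.pow_apply_coe, ← map_pow, ← Units.val_pow_eq_pow_val, h]; simp
  refine ⟨ω⁻¹, hord, ?_⟩
  intro χ hχ1 hχ2 a c ha hc hc0 hac hJ
  set T := ω⁻¹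
  have hord' : ∀ a, 0 < a → a < Fintype.card F - 1 → T ^ a ≠ 1 := by
    intro a h1 h2 h3
    exact absurd (Nat.le_of_dvd h1 ((hord a).1 h3)) (by omega)
  have hst := stick F p A T hT ι hTι hord' ψ hψ hψp
  have hq0 : ((p ^ n : ℕ) : ℂ) ≠ 0 := by exact_mod_cast (pow_pos hp.pos n).ne'
  have hvq : A.valuation ((p ^ n : ℕ) : ℂ) < 1 := by
    push_cast; rw [map_pow]; exact pow_lt_one₀ zero_le hA hn.ne'
  have hχG : A.valuation (gaussSum χ ψ) = A.valuation ((p ^ n : ℕ) : ℂ) := by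
    have h1 := gaussSum_sq hχ1 hχ2 hψ
    rw [hcard] at h1
    have h2 : A.valuation (χ (-1)) = 1 := by
      apply mem_of_pow_one A two_ne_zero
      rw [← map_pow]; simp
    have h3 := congrArg A.valuation h1
    rw [map_mul, h2, one_mul, map_pow, Nat.cast_pow, map_pow] at h3
    exact (pow_left_inj₀ zero_le zero_le two_ne_zero).1 h3
  have hJ2 := jacobiSum_mul_nontrivial (χ := T ^ a) (φ := χ) (by rw [hac]; exact hord' c hc0 hc) ψ
  rw [hJ, hac] at hJ2
  have h3 := congrArg A.valuation hJ2
  rw [map_mul, map_mul, hχG] at h3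
  have hvq0 : A.valuation ((p ^ n : ℕ) : ℂ) ≠ 0 := by
    rw [Ne, map_eq_zero]; exact hq0
  have h4 := mul_right_cancel₀ hvq0 h3
  rw [hst a ha, hst c hc] at h4
  have hχT : ∃ b, b < Fintype.card F - 1 ∧ χ = T ^ b := by
    refine ⟨(c + (Fintype.card F - 1 - a)) % (Fintype.card F - 1), Nat.mod_lt _ (by omega), ?_⟩
    have hone : T ^ (Fintype.card F - 1) = 1 := (hord _).2 dvd_rfl
    have : T ^ ((c + (Fintype.card F - 1 - a)) % (Fintype.card F - 1)) = T ^ (c + (Fintype.card F - 1 - a)) := by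
      conv_rhs => rw [← Nat.mod_add_div (c + (Fintype.card F - 1 - a)) (Fintype.card F - 1)]
      rw [pow_add, pow_mul, hone, one_pow, mul_one]
    rw [this, pow_add, ← hac, mul_right_comm, ← pow_add, Nat.add_sub_cancel' ha.le, hone, one_mul]
  obtain ⟨b, hb, rfl⟩ := hχT
  rw [hst b hb] at hχG
  set x := A.valuation (gaussSum T ψ)
  have hx1 : x ≠ 1 := by
    intro h; rw [h, one_pow] at hχG; rw [← hχG] at hvq; exact lt_irrefl _ hvq
  have hsb : (p.digits b).sum ≠ 0 := by
    intro h; rw [h, pow_zero] at hχG; rw [← hχG] at hvq; exact lt_irrefl _ hvq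
  have hx0 : x ≠ 0 := by
    intro h; rw [h, zero_pow hsb] at hχG; exact hvq0 hχG.symm
  exact (pow_right_injective₀ (zero_lt_iff.2 hx0) hx1 h4).symm


lemma count_eq (F : Type) [Field F] [Fintype F] [DecidableEq F] (hF : ringChar F ≠ 2) (d : ℕ) :
    (chebAffineCount F d : ℤ) = Fintype.card F +
      ∑ x : F, quadraticChar F ((dickson 1 (1 : F) d).eval x) := by
  have h1 : chebAffineCount F d =
      ∑ x : F, Fintype.card {y : F // y ^ 2 = (dickson 1 (1 : F) d).eval x} := by
    unfold chebAffineCount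
    rw [← Fintype.card_sigma, ← Nat.card_eq_fintype_card]
    apply Nat.card_congr
    exact
      { toFun := fun z => ⟨z.1.1, z.1.2, z.2⟩
        invFun := fun z => ⟨(z.1, z.2.1), z.2.2⟩
        left_inv := fun _ => rfl
        right_inv := fun _ => rfl }
  have h2 : ∀ a : F, (Fintype.card {y : F // y ^ 2 = a} : ℤ) = quadraticChar F a + 1 := by
    intro a
    rw [← quadraticChar_card_sqrts hF a]
    congr 1
    rw [Set.toFinset_card]
    exact Fintype.card_congr (Equiv.refl _)
  rw [h1]
  push_cast
  simp only [h2, Finset.sum_add_distrib]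
  simp; ring

lemma sumA (F : Type) [Field F] [Fintype F] [DecidableEq F] (hF : ringChar F ≠ 2) (f : F → ℤ) :
    ∑ t : Fˣ, f ((t : F) + (t : F)⁻¹) = ∑ x : F, (1 + quadraticChar F (x ^ 2 - 4)) * f x := by
  have h2 : (2 : F) ≠ 0 := Ring.two_ne_zero hF
  rw [← Finset.sum_fiberwise (s := Finset.univ) (g := fun t : Fˣ => (t : F) + (t : F)⁻¹)]
  apply Finset.sum_congr rfl
  intro x _
  have h3 : ∀ t ∈ (Finset.univ : Finset Fˣ).filter (fun t : Fˣ => (t : F) + (t : F)⁻¹ = x),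
      f ((t : F) + (t : F)⁻¹) = f x := by
    intro t ht; rw [(Finset.mem_filter.1 ht).2]
  rw [Finset.sum_congr rfl h3, Finset.sum_const, nsmul_eq_mul]
  congr 1
  rw [add_comm, ← quadraticChar_card_sqrts hF]
  congr 1
  apply Finset.card_bij (fun (t : Fˣ) _ => 2 * (t : F) - x)
  · intro t ht
    have h := (Finset.mem_filter.1 ht).2
    simp only [Set.mem_toFinset]
    show (2 * (t : F) - x) ^ 2 = x ^ 2 - 4
    rw [← h]
    have := t.ne_zero
    field_simp
    ring
  · intro a _ b _ h
    apply Units.ext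
    have : 2 * (a : F) = 2 * b := by linear_combination h
    exact mul_left_cancel₀ h2 this
  · intro s hs
    simp only [Set.mem_toFinset] at hs
    have hs : s ^ 2 = x ^ 2 - 4 := hs
    have h4 : (s + x) / 2 * ((x - s) / 2) = 1 := by
      field_simp
      linear_combination -hs
    refine ⟨⟨(s + x) / 2, (x - s) / 2, h4, by rw [mul_comm]; exact h4⟩, ?_, ?_⟩
    · simp only [Finset.mem_filter, Finset.mem_univ, true_and]
      rw [inv_eq_of_mul_eq_one_right h4]
      field_simp; ring
    · simp only; field_simp; ring

/-- Parametrization of the complement. -/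
lemma paramS (F K : Type) [Field F] [Fintype F] [DecidableEq F] [Field K] [Algebra F K] [IsAlgClosed K] (p f : ℕ) [Fact p.Prime] [CharP F p]
    (hF : ringChar F ≠ 2) (hcard : Fintype.card F = p ^ f) (x : F) :
    quadraticChar F (x ^ 2 - 4) ≠ 1 ↔
      ∃ t : K, t ^ (Fintype.card F + 1) = 1 ∧
        t + t⁻¹ = algebraMap F (K) x := by
  have : CharP K p := charP_of_injective_algebraMap (algebraMap F K).injective p
  have h2F : (2 : F) ≠ 0 := Ring.two_ne_zero hF
  have h2 : (2 : K) ≠ 0 := by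
    rw [← map_ofNat (algebraMap F K) 2]; exact (_root_.map_ne_zero _).2 h2F
  have hodd : Fintype.card F % 2 = 1 := FiniteField.odd_card_of_char_ne_two hF
  set Q := Fintype.card F with hQ
  have hadd : ∀ a b : K, (a + b) ^ Q = a ^ Q + b ^ Q := by
    intro a b; rw [hcard]; exact add_pow_char_pow a b p f
  have hsub : ∀ a b : K, (a - b) ^ Q = a ^ Q - b ^ Q := by
    intro a b; rw [hcard]; exact sub_pow_char_pow a b f
  have hQ1 : 1 < Q := Fintype.one_lt_card
  have heuler : ∀ s : K, s ^ 2 = algebraMap F K (x ^ 2 - 4) →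
      s ^ (Q - 1) = algebraMap F K (quadraticChar F (x ^ 2 - 4) : F) := by
    intro s hs
    rw [quadraticChar_eq_pow_of_char_ne_two' hF, map_pow, ← hs, ← pow_mul]
    congr 1; omega
  have hsq : ∀ t : K, t ≠ 0 → t + t⁻¹ = algebraMap F K x →
      (t - t⁻¹) ^ 2 = algebraMap F K (x ^ 2 - 4) := by
    intro t ht h
    rw [map_sub, map_pow, ← h, map_ofNat]; field_simp; ring
  constructor
  · intro hx
    obtain ⟨s, hs⟩ := IsAlgClosed.exists_pow_nat_eq (algebraMap F K (x ^ 2 - 4)) two_pos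
    set y := algebraMap F K x with hy
    have hs' : s ^ 2 = y ^ 2 - 4 := by rw [hs, map_sub, map_pow, map_ofNat]
    have h4 : (s + y) / 2 * ((y - s) / 2) = 1 := by
      field_simp
      linear_combination -hs'
    obtain ⟨t, ht⟩ : ∃ t, t = (s + y) / 2 := ⟨_, rfl⟩
    have ht0 : t ≠ 0 := by rintro rfl; rw [← ht, zero_mul] at h4; exact zero_ne_one h4
    have hinv : t⁻¹ = (y - s) / 2 := by rw [ht]; exact inv_eq_of_mul_eq_one_right h4
    have hty : t + t⁻¹ = y := by rw [hinv, ht]; field_simp; ring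
    refine ⟨t, ?_, hty⟩
    have hfrob : t ^ Q + (t ^ Q)⁻¹ = t + t⁻¹ := by
      rw [← inv_pow, ← hadd, hty, hy, ← map_pow, FiniteField.pow_card]
    have htQ0 : t ^ Q ≠ 0 := pow_ne_zero _ ht0
    have hfac : (t ^ Q - t) * (t ^ Q * t - 1) = 0 := by
      field_simp at hfrob
      linear_combination hfrob
    rcases mul_eq_zero.1 hfac with h | h
    · have h5 : t ^ Q = t := sub_eq_zero.1 h
      have h6 : (t - t⁻¹) ^ Q = t - t⁻¹ := by rw [hsub, inv_pow, h5]
      have h7 := hsq t ht0 hty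
      have h8 := heuler _ h7
      have h9 : (t - t⁻¹) = 0 := by
        by_contra hne
        have h10 : (t - t⁻¹) ^ (Q - 1) = 1 := by
          apply mul_right_cancel₀ hne
          rw [← pow_succ, Nat.sub_add_cancel hQ1.le, h6, one_mul]
        rw [h10] at h8
        have h11 : x ^ 2 - 4 ≠ 0 := by
          intro h0; rw [h0, map_zero] at h7; exact hne (pow_eq_zero_iff two_ne_zero |>.1 h7)
        rcases quadraticChar_dichotomy h11 with h | h
        · exact hx h
        · rw [h] at h8
          apply h2
          push_cast at h8
          linear_combination h8
      have h10 : t ^ 2 = 1 := by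
        have : t = t⁻¹ := sub_eq_zero.1 h9
        rw [pow_two]; nth_rewrite 2 [this]; exact mul_inv_cancel₀ ht0
      obtain ⟨c, hc⟩ : ∃ c, Q + 1 = 2 * c := ⟨(Q + 1) / 2, by omega⟩
      rw [hc, pow_mul, h10, one_pow]
    · rw [pow_succ]; exact sub_eq_zero.1 h
  · rintro ⟨t, ht1, hty⟩ hx
    have ht0 : t ≠ 0 := by rintro rfl; simp at ht1
    have h7 := hsq t ht0 hty
    have h8 := heuler _ h7
    rw [hx] at h8
    have hne : t - t⁻¹ ≠ 0 := by
      intro h0; rw [h0, zero_pow (by omega)] at h8; simp at h8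
    have htQ : t ^ Q = t⁻¹ := eq_inv_of_mul_eq_one_left (by rw [← pow_succ]; exact ht1)
    have h9 : (t - t⁻¹) ^ Q = -(t - t⁻¹) := by rw [hsub, inv_pow, htQ, inv_inv]; ring
    have h10 : (t - t⁻¹) ^ Q = (t - t⁻¹) := by
      rw [← Nat.sub_add_cancel hQ1.le, pow_succ, h8]; simp
    rw [h10] at h9
    apply hne
    have : 2 * (t - t⁻¹) = 0 := by linear_combination h9
    exact (mul_eq_zero.1 this).resolve_left h2

lemma sumB (F K : Type) [Field F] [Fintype F] [DecidableEq F] [Field K] [Algebra F K] [IsAlgClosed K] (p f : ℕ) [Fact p.Prime] [CharP F p]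
    (hF : ringChar F ≠ 2) (hcard : Fintype.card F = p ^ f) (d : ℕ)
    (hcop : Nat.Coprime d (Fintype.card F + 1)) (f : F → ℤ) :
    ∑ x : F, (1 - quadraticChar F (x ^ 2 - 4)) * f ((dickson 1 (1 : F) d).eval x) =
    ∑ x : F, (1 - quadraticChar F (x ^ 2 - 4)) * f x := by
  set Φ : F → F := fun x => (dickson 1 (1 : F) d).eval x with hΦ
  set Q := Fintype.card F with hQ
  set S : Finset F := Finset.univ.filter (fun x => quadraticChar F (x ^ 2 - 4) ≠ 1) with hS
  have hparam := paramS F K p _ hF hcard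
  have hmap : ∀ (x : F) (t : K), t ≠ 0 → t + t⁻¹ = algebraMap F K x →
      t ^ d + (t ^ d)⁻¹ = algebraMap F K (Φ x) := by
    intro x t ht h
    have h1 := Polynomial.dickson_one_one_eval_add_inv t t⁻¹ (mul_inv_cancel₀ ht) d
    rw [inv_pow] at h1
    rw [← h1, h, hΦ]
    have : dickson 1 (1 : K) d = (dickson 1 (1 : F) d).map (algebraMap F K) := by
      rw [map_dickson, map_one]
    rw [this, eval_map, eval₂_at_apply]
  have hne0 : ∀ t : K, t ^ (Q + 1) = 1 → t ≠ 0 := by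
    rintro t ht rfl; simp at ht
  have hcanc : ∀ t : K, t ^ d = 1 → t ^ (Q + 1) = 1 → t = 1 := by
    intro t h1 h2
    have h3 := orderOf_dvd_of_pow_eq_one h1
    have h4 := orderOf_dvd_of_pow_eq_one h2
    exact orderOf_eq_one_iff.1 (Nat.eq_one_of_dvd_coprimes hcop h3 h4)
  have hsumeq : ∀ a b : K, a ≠ 0 → b ≠ 0 → a + a⁻¹ = b + b⁻¹ → a = b ∨ a * b = 1 := by
    intro a b ha hb h
    have : (a - b) * (a * b - 1) = 0 := by
      field_simp at h
      linear_combination h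
    rcases mul_eq_zero.1 this with h | h
    · left; exact sub_eq_zero.1 h
    · right; exact sub_eq_zero.1 h
  have hmaps : ∀ x ∈ S, Φ x ∈ S := by
    intro x hx
    simp only [hS, Finset.mem_filter, Finset.mem_univ, true_and] at hx ⊢
    obtain ⟨t, ht1, ht2⟩ := (hparam x).1 hx
    exact (hparam _).2 ⟨t ^ d, by rw [← pow_mul, mul_comm, pow_mul, ht1, one_pow], hmap x t (hne0 t ht1) ht2⟩
  have hinj : Set.InjOn Φ (S : Set F) := by
    intro x hx y hy hxy
    simp only [hS, Finset.coe_filter, Finset.mem_univ, true_and, Set.mem_ofPred_eq] at hx hy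
    obtain ⟨t, ht1, ht2⟩ := (hparam x).1 hx
    obtain ⟨u, hu1, hu2⟩ := (hparam y).1 hy
    have ht0 := hne0 t ht1
    have hu0 := hne0 u hu1
    apply (algebraMap F K).injective
    rw [← ht2, ← hu2]
    have h1 := hmap x t ht0 ht2
    rw [hxy, ← hmap y u hu0 hu2] at h1
    rcases hsumeq _ _ (pow_ne_zero _ ht0) (pow_ne_zero _ hu0) h1 with h | h
    · have : t * u⁻¹ = 1 := by
        apply hcanc
        · rw [mul_pow, h, inv_pow, mul_inv_cancel₀ (pow_ne_zero _ hu0)]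
        · rw [mul_pow, inv_pow, ht1, hu1]; simp
      have : t = u := by field_simp at this; exact this
      rw [this]
    · have : t * u = 1 := by
        apply hcanc
        · rw [mul_pow, h]
        · rw [mul_pow, ht1, hu1]; simp
      have : t = u⁻¹ := eq_inv_of_mul_eq_one_left this
      rw [this, inv_inv, add_comm]
  have himg : S.image Φ = S := by
    apply Finset.eq_of_subset_of_card_le
    · intro y hy
      obtain ⟨x, hx, rfl⟩ := Finset.mem_image.1 hy
      exact hmaps x hx
    · rw [Finset.card_image_of_injOn hinj]
  have hrestrict : ∀ g : F → ℤ, ∑ x : F, (1 - quadraticChar F (x ^ 2 - 4)) * g x =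
      ∑ x ∈ S, (1 - quadraticChar F (x ^ 2 - 4)) * g x := by
    intro g
    symm
    apply Finset.sum_subset (Finset.subset_univ _)
    intro x _ hx
    simp only [hS, Finset.mem_filter, Finset.mem_univ, true_and, not_not] at hx
    rw [hx]; simp
  have hsq4 : ∀ (x : F) (t : K), t ≠ 0 → t + t⁻¹ = algebraMap F K x → (x ^ 2 - 4 = 0 ↔ t ^ 2 = 1) := by
    intro x t ht h
    have e : algebraMap F K (x ^ 2 - 4) = ((t ^ 2 - 1) / t) ^ 2 := by
      rw [map_sub, map_pow, ← h, map_ofNat]; field_simp; ring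
    rw [← map_eq_zero (algebraMap F K), e, pow_eq_zero_iff two_ne_zero, div_eq_zero_iff, sub_eq_zero]
    simp [ht]
  have hw : ∀ x ∈ S, quadraticChar F (x ^ 2 - 4) = quadraticChar F ((Φ x) ^ 2 - 4) := by
    intro x hx
    have hx' := hmaps x hx
    simp only [hS, Finset.mem_filter, Finset.mem_univ, true_and] at hx hx'
    obtain ⟨t, ht1, ht2⟩ := (hparam x).1 hx
    have ht0 := hne0 t ht1
    have e1 := hsq4 x t ht0 ht2
    have e2 := hsq4 (Φ x) (t ^ d) (pow_ne_zero _ ht0) (hmap x t ht0 ht2)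
    have e3 : t ^ 2 = 1 ↔ (t ^ d) ^ 2 = 1 := by
      constructor
      · intro h; rw [← pow_mul, mul_comm, pow_mul, h, one_pow]
      · intro h
        apply hcanc
        · rw [← h, ← pow_mul, ← pow_mul, mul_comm]
        · rw [← pow_mul, mul_comm, pow_mul, ht1, one_pow]
    by_cases h0 : x ^ 2 - 4 = 0
    · have h1 := e2.2 (e3.1 (e1.1 h0))
      rw [h0, h1]
    · have h1 : (Φ x) ^ 2 - 4 ≠ 0 := fun h => h0 (e1.2 (e3.2 (e2.1 h)))
      rw [(quadraticChar_dichotomy h0).resolve_left hx, (quadraticChar_dichotomy h1).resolve_left hx']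
  rw [hrestrict, hrestrict]
  conv_rhs => rw [← himg]
  rw [Finset.sum_image hinj]
  apply Finset.sum_congr rfl
  intro x hx
  rw [hw x hx]

/-- `2 S = A_d - A_1`. -/
lemma twoS (F : Type) [Field F] [Fintype F] [DecidableEq F] (p f : ℕ) [Fact p.Prime] [CharP F p]
    (hF : ringChar F ≠ 2) (hcard : Fintype.card F = p ^ f) (d : ℕ)
    (hcop : Nat.Coprime d (Fintype.card F + 1)) :
    2 * ∑ x : F, quadraticChar F ((dickson 1 (1 : F) d).eval x) =
      ∑ t : Fˣ, quadraticChar F ((t : F) ^ d + ((t : F) ^ d)⁻¹) -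
      ∑ t : Fˣ, quadraticChar F ((t : F) + (t : F)⁻¹) := by
  have hA := sumA F hF (fun x => quadraticChar F ((dickson 1 (1 : F) d).eval x))
  have hA1 := sumA F hF (fun x => quadraticChar F x)
  have hB := sumB F (AlgebraicClosure F) p f hF hcard d hcop (fun x => quadraticChar F x)
  have h0 := quadraticChar_sum_zero hF
  have hA' : ∀ t : Fˣ, (dickson 1 (1 : F) d).eval ((t : F) + (t : F)⁻¹) =
      (t : F) ^ d + ((t : F) ^ d)⁻¹ := by
    intro t
    rw [Polynomial.dickson_one_one_eval_add_inv _ _ (mul_inv_cancel₀ t.ne_zero), inv_pow]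
  simp only [hA'] at hA
  rw [hA, hA1]
  simp only [add_mul, sub_mul, one_mul, Finset.sum_add_distrib, Finset.sum_sub_distrib] at hB ⊢
  rw [h0] at hB ⊢
  linear_combination hB


lemma pow_one_imp (F : Type) [Field F] [Fintype F] (T : MulChar F ℂ)
    (hT : ∀ a, T ^ a = 1 ↔ Fintype.card F - 1 ∣ a) (n M : ℕ) (hn : n * M = Fintype.card F - 1)
    (u : Fˣ) (hu : T u ^ M = 1) : ∃ t : Fˣ, u = t ^ n := by
  obtain ⟨g, hg⟩ := IsCyclic.exists_monoid_generator (α := Fˣ)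
  have hgz : ∀ x, x ∈ Subgroup.zpowers g := by
    intro x
    obtain ⟨k, hk⟩ := Submonoid.mem_powers_iff _ _ |>.1 (hg x)
    rw [← hk]; exact Subgroup.npow_mem_zpowers g k
  obtain ⟨k, hk⟩ := Submonoid.mem_powers_iff _ _ |>.1 (hg u)
  have hN : 0 < Fintype.card F - 1 := by have := Fintype.one_lt_card (α := F); omega
  have hM : 0 < M := Nat.pos_of_ne_zero (by rintro rfl; omega)
  have h1 : T ^ (k * M) = 1 := by
    rw [MulChar.eq_iff hgz, MulChar.pow_apply_coe, MulChar.one_apply_coe, pow_mul, ← map_pow,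
      ← Units.val_pow_eq_pow_val, hk, hu]
  rw [hT, ← hn] at h1
  obtain ⟨c, hc⟩ := Nat.dvd_of_mul_dvd_mul_right hM h1
  exact ⟨g ^ c, by rw [← hk, hc, ← pow_mul, mul_comm]⟩

lemma char_pow_card (F : Type) [Field F] [Fintype F] (T : MulChar F ℂ) (u : Fˣ) :
    T u ^ (Fintype.card F - 1) = 1 := by
  rw [← map_pow, FiniteField.pow_card_sub_one_eq_one _ u.ne_zero, map_one]

lemma powsum (F : Type) [Field F] [Fintype F] [DecidableEq F] (T : MulChar F ℂ)
    (hT : ∀ a, T ^ a = 1 ↔ Fintype.card F - 1 ∣ a) (n M : ℕ) (hn : n * M = Fintype.card F - 1)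
    (g : Fˣ → ℂ) :
    ∑ t : Fˣ, g (t ^ n) = ∑ j ∈ Finset.range n, ∑ u : Fˣ, T u ^ (M * j) * g u := by
  classical
  rw [Finset.sum_comm, ← Finset.sum_fiberwise (s := Finset.univ) (g := fun t : Fˣ => t ^ n)]
  apply Finset.sum_congr rfl
  intro u _
  rw [← Finset.sum_mul]
  have h3 : ∀ t ∈ (Finset.univ : Finset Fˣ).filter (fun t : Fˣ => t ^ n = u),
      g (t ^ n) = g u := by
    intro t ht; rw [(Finset.mem_filter.1 ht).2]
  rw [Finset.sum_congr rfl h3, Finset.sum_const, nsmul_eq_mul]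
  congr 1
  simp only [pow_mul]
  by_cases hu : T u ^ M = 1
  · rw [hu]
    simp only [one_pow, Finset.sum_const, Finset.card_range, nsmul_eq_mul, mul_one]
    obtain ⟨t0, ht0⟩ := pow_one_imp F T hT n M hn u hu
    have h4 : Nat.card (powMonoidHom n : Fˣ →* Fˣ).ker = n := by
      rw [IsCyclic.card_powMonoidHom_ker, Nat.card_eq_fintype_card, Fintype.card_units, ← hn]
      exact Nat.gcd_eq_right (Dvd.intro _ rfl)
    congr 1
    conv_rhs => rw [← h4]
    rw [Nat.card_eq_fintype_card, Fintype.card_subtype]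
    apply Finset.card_bij (fun (t : Fˣ) _ => t * t0⁻¹)
    · intro t ht
      have := (Finset.mem_filter.1 ht).2
      simp only [Finset.mem_filter, Finset.mem_univ, true_and, MonoidHom.mem_ker, powMonoidHom_apply]
      rw [mul_pow, this, ht0, inv_pow, mul_inv_cancel]
    · intro a _ b _ h
      exact mul_right_cancel h
    · intro b hb
      simp only [Finset.mem_filter, Finset.mem_univ, true_and, MonoidHom.mem_ker, powMonoidHom_apply] at hb
      refine ⟨b * t0, ?_, by group⟩
      simp only [Finset.mem_filter, Finset.mem_univ, true_and]
      rw [mul_pow, hb, one_mul, ht0]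
  · have h5 : (T u ^ M) ^ n = 1 := by
      rw [← pow_mul, mul_comm, hn, char_pow_card]
    have h6 := geom_sum_mul (T u ^ M) n
    rw [h5, sub_self] at h6
    rw [(mul_eq_zero.1 h6).resolve_right (sub_ne_zero.2 hu)]
    rw [Finset.filter_false_of_mem]
    · simp
    · intro t _ ht
      apply hu
      rw [← ht, Units.val_pow_eq_pow_val, map_pow, ← pow_mul, hn, char_pow_card]

lemma norm_jacobi (F : Type) [Field F] [Fintype F] (q : ℕ) (hcard : Fintype.card F = q ^ 2)
    (χ φ : MulChar F ℂ) (h1 : χ ≠ 1) (h2 : φ ≠ 1) (h3 : χ * φ ≠ 1) : ‖jacobiSum χ φ‖ = q := by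
  classical
  have hc : ringChar ℂ ≠ ringChar F := by
    rw [ringChar.eq_zero]
    exact (CharP.ringChar_ne_zero_of_finite F).symm
  have h := jacobiSum_mul_jacobiSum_inv hc h1 h2 h3
  have hs : jacobiSum χ⁻¹ φ⁻¹ = star (jacobiSum χ φ) := by
    simp only [jacobiSum, star_sum, star_mul', MulChar.star_apply']
  rw [hs, hcard] at h
  have h4 := congrArg norm h
  rw [norm_mul, norm_star] at h4
  push_cast at h4
  rw [norm_pow, Complex.norm_natCast] at h4
  rw [← pow_two] at h4
  exact (pow_left_inj₀ (norm_nonneg _) (Nat.cast_nonneg q) two_ne_zero).1 h4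

lemma all_eq (s : Finset ℕ) (z : ℕ → ℂ) (r : ℕ) (hz : ∀ i ∈ s, ‖z i‖ = r)
    (hsum : ∑ i ∈ s, z i = s.card * r) : ∀ i ∈ s, z i = r := by
  have hre : ∑ i ∈ s, (z i).re = ∑ i ∈ s, (r : ℝ) := by
    have := congrArg Complex.re hsum
    rw [Complex.re_sum] at this
    rw [this, Finset.sum_const, nsmul_eq_mul]
    norm_cast
  have hle : ∀ i ∈ s, (z i).re ≤ r := fun i hi => (Complex.re_le_norm _).trans (hz i hi).le
  have heq := (Finset.sum_eq_sum_iff_of_le hle).1 hre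
  intro i hi
  have h1 := heq i hi
  have h2 := hz i hi
  have h3 := Complex.sq_norm (z i)
  rw [h2, Complex.normSq_apply, h1] at h3
  have h4 : (z i).im = 0 := by
    have : (z i).im * (z i).im = 0 := by linarith
    exact mul_self_eq_zero.1 this
  apply Complex.ext
  · simpa using h1
  · simpa using h4

lemma bsum (F : Type) [Field F] [Fintype F] [DecidableEq F] (ψ χ : MulChar F ℂ) (h : ψ (-1) = 1) :
    ∑ u : Fˣ, ψ u * χ (u + 1) = jacobiSum ψ χ := by
  have h1 : ∑ u : Fˣ, ψ u * χ (u + 1) = ∑ x : F, ψ x * χ (x + 1) := by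
    apply Fintype.sum_of_injective (fun u : Fˣ => (u : F)) (fun a b h => Units.ext h)
    · intro x hx
      have : ¬ IsUnit x := fun ⟨u, hu⟩ => hx ⟨u, hu⟩
      rw [MulChar.map_nonunit ψ this, zero_mul]
    · intro u; rfl
  rw [h1, jacobiSum, ← Equiv.sum_comp (Equiv.neg F)]
  apply Finset.sum_congr rfl
  intro x _
  simp only [Equiv.neg_apply]
  have : ψ (-x) = ψ x := by rw [← neg_one_mul, map_mul, h, one_mul]
  rw [this]; congr 2; ring

lemma quad_eq (F : Type) [Field F] [Fintype F] [DecidableEq F] (hF : ringChar F ≠ 2) (T : MulChar F ℂ)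
    (hT : ∀ a, T ^ a = 1 ↔ Fintype.card F - 1 ∣ a) (M : ℕ) (hM : 2 * M = Fintype.card F - 1) :
    (quadraticChar F).ringHomComp (Int.castRingHom ℂ) = T ^ M := by
  ext u
  rw [MulChar.ringHomComp_apply, MulChar.pow_apply_coe]
  by_cases hu : T u ^ M = 1
  · obtain ⟨t, rfl⟩ := pow_one_imp F T hT 2 M hM u hu
    rw [hu, Units.val_pow_eq_pow_val, quadraticChar_sq_one' t.ne_zero]; simp
  · have h1 : (T u ^ M) ^ 2 = 1 := by rw [← pow_mul, mul_comm, hM, char_pow_card]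
    rw [(show T u ^ M = 1 ∨ T u ^ M = -1 from by simpa using h1).resolve_left hu]
    rcases quadraticChar_dichotomy u.ne_zero with h | h
    · exfalso
      rw [quadraticChar_one_iff_isSquare u.ne_zero] at h
      obtain ⟨v, hv⟩ := h
      have hv0 : v ≠ 0 := by rintro rfl; exact u.ne_zero (by simpa using hv)
      apply hu
      rw [hv, ← pow_two, map_pow, ← pow_mul, hM]
      exact char_pow_card F T (Units.mk0 v hv0)
    · rw [h]; simp

lemma split_case (F : Type) [Field F] [Fintype F] [DecidableEq F] (hF : ringChar F ≠ 2) (T : MulChar F ℂ)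
    (hT : ∀ a, T ^ a = 1 ↔ Fintype.card F - 1 ∣ a) (l m q : ℕ) (hq : Fintype.card F = q ^ 2)
    (hl : l % 2 = 1) (hm2 : m % 2 = 0) (hm : 4 * l * m = Fintype.card F - 1)
    (hA : (∑ t : Fˣ, quadraticChar F ((t : F) ^ l + ((t : F) ^ l)⁻¹) : ℤ) -
      ∑ t : Fˣ, quadraticChar F ((t : F) + (t : F)⁻¹) = (2 * l - 2) * q) :
    ∀ j < 2 * l, j ≠ 0 → j ≠ l → jacobiSum (T ^ ((2 * j + l) * m)) (T ^ (2 * l * m)) = q := by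
  have hN : 0 < Fintype.card F - 1 := by have := Fintype.one_lt_card (α := F); omega
  have hm0 : 0 < m := Nat.pos_of_ne_zero (by rintro rfl; omega)
  have hl0 : 0 < l := by omega
  have hχ := quad_eq F hF T hT (2 * l * m) (by rw [← hm]; ring)
  have hχ' : ∀ x : F, ((quadraticChar F x : ℤ) : ℂ) = (T ^ (2 * l * m)) x := by
    intro x; rw [← hχ]; simp
  have hneg : ∀ k, (T ^ (k * m)) (-1) = 1 := by
    intro k
    have := MulChar.pow_apply_coe T (k * m) (-1)
    rw [Units.val_neg, Units.val_one] at this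
    rw [this, ← map_pow]
    have : Even (k * m) := Even.mul_left (Nat.even_iff.2 hm2) k
    rw [this.neg_one_pow, map_one]
  have hne : ∀ k, k % 2 = 1 → T ^ (k * m) ≠ 1 := by
    intro k hk h
    rw [hT, ← hm] at h
    have := Nat.dvd_of_mul_dvd_mul_right hm0 h
    have : 2 ∣ k := (Dvd.intro (2 * l) (by ring)).trans this
    omega
  set g : Fˣ → ℂ := fun u => (T ^ (l * m)) u * (T ^ (2 * l * m)) (u + 1) with hg
  have hs : ∀ s : Fˣ, (T ^ (2 * l * m)) ((s : F) + (s : F)⁻¹) = g (s ^ 2) := by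
    intro s
    have e : (s : F) + (s : F)⁻¹ = s * ((s⁻¹ : Fˣ) : F) ^ 2 * (((s ^ 2 : Fˣ) : F) + 1) := by
      have := s.ne_zero
      push_cast
      field_simp
    rw [e, map_mul, map_mul, hg]
    congr 1
    rw [MulChar.pow_apply_coe, MulChar.pow_apply_coe, ← Units.val_pow_eq_pow_val, MulChar.pow_apply_coe]
    have : T ((s⁻¹ ^ 2 : Fˣ) : F) ^ (2 * l * m) = 1 := by
      rw [Units.val_pow_eq_pow_val, map_pow, ← pow_mul, ← mul_assoc, ← mul_assoc, show 2 * 2 * l * m = 4 * l * m by ring, hm]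
      exact char_pow_card F T s⁻¹
    rw [this, mul_one, Units.val_pow_eq_pow_val, map_pow, ← pow_mul]
    congr 1; ring
  set J : ℕ → ℂ := fun j => jacobiSum (T ^ ((2 * j + l) * m)) (T ^ (2 * l * m)) with hJ
  have hterm : ∀ j M, M = 2 * j * m → ∑ u : Fˣ, T u ^ M * g u = J j := by
    intro j M hM
    rw [hJ]
    simp only
    rw [← bsum _ _ _ (hneg _)]
    apply Finset.sum_congr rfl
    intro u _
    rw [hg]
    simp only
    rw [← mul_assoc]
    congr 1
    rw [MulChar.pow_apply_coe, MulChar.pow_apply_coe, ← pow_add, hM]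
    congr 1; ring
  have hAl : ∑ t : Fˣ, (T ^ (2 * l * m)) ((t : F) ^ l + ((t : F) ^ l)⁻¹) =
      ∑ j ∈ Finset.range (2 * l), J j := by
    have : ∀ t : Fˣ, (T ^ (2 * l * m)) ((t : F) ^ l + ((t : F) ^ l)⁻¹) = g (t ^ (2 * l)) := by
      intro t
      rw [← Units.val_pow_eq_pow_val, hs, ← pow_mul, mul_comm]
    simp only [this]
    rw [powsum F T hT (2 * l) (2 * m) (by rw [← hm]; ring)]
    apply Finset.sum_congr rfl
    intro j _
    exact hterm j _ (by ring)
  have hA1 : ∑ t : Fˣ, (T ^ (2 * l * m)) ((t : F) + (t : F)⁻¹) = J 0 + J l := by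
    simp only [hs]
    rw [powsum F T hT 2 (2 * l * m) (by rw [← hm]; ring), Finset.sum_range_succ, Finset.sum_range_one,
      hterm 0 _ (by ring), hterm l _ (by ring)]
  have hA' := congrArg (Int.cast : ℤ → ℂ) hA
  push_cast at hA'
  simp only [hχ'] at hA'
  rw [hAl, hA1] at hA'
  have h0mem : 0 ∈ Finset.range (2 * l) := by simp; omega
  have hlmem : l ∈ (Finset.range (2 * l)).erase 0 := by simp; omega
  rw [← Finset.add_sum_erase _ _ h0mem, ← Finset.add_sum_erase _ _ hlmem] at hA'
  have hcard : (((Finset.range (2 * l)).erase 0).erase l).card = 2 * l - 2 := by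
    rw [Finset.card_erase_of_mem hlmem, Finset.card_erase_of_mem h0mem, Finset.card_range]; omega
  have hall := all_eq (((Finset.range (2 * l)).erase 0).erase l) J q ?_ ?_
  · intro j h1 h2 h3
    exact hall j (by simp [h1, h2, h3])
  · intro j hj
    apply norm_jacobi F q hq
    · exact hne _ (by omega)
    · intro h
      rw [hT, ← hm] at h
      have := Nat.le_of_dvd (by positivity) h
      have : 0 < l * m := by positivity
      nlinarith
    · rw [← pow_add, ← add_mul]; exact hne _ (by omega)
  · rw [hcard]
    push_cast [show 2 ≤ 2 * l by omega]
    linear_combination hA'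

theorem statement0 (l p : ℕ) (hl : l.Prime) (hl4 : l % 4 = 3)
    (hp : p.Prime) (hp4 : p % 4 = 1) (n : ℕ) (hn : 0 < n) :
    ¬ chebMaximal l (p ^ n) := by
  intro hmax
  classical
  have : Fact p.Prime := ⟨hp⟩
  have : Fact l.Prime := ⟨hl⟩
  let _ : Fintype (GaloisField p (2 * n)) := Fintype.ofFinite _
  have hcardp : Fintype.card (GaloisField p (2 * n)) = p ^ (2 * n) := by
    rw [← Nat.card_eq_fintype_card, GaloisField.card p _ (by omega)]
  have hcard : Fintype.card (GaloisField p (2 * n)) = (p ^ n) ^ 2 := by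
    rw [hcardp, ← pow_mul, mul_comm]
  have hF : ringChar (GaloisField p (2 * n)) ≠ 2 := by
    rw [ringChar.eq (GaloisField p (2 * n)) p]; omega
  have hc := hmax (GaloisField p (2 * n)) hcard
  have hce := count_eq (GaloisField p (2 * n)) hF l
  have hlp : ¬ l ∣ (p ^ n) ^ 2 + 1 := by
    intro h
    have h1 : (((p ^ n) ^ 2 + 1 : ℕ) : ZMod l) = 0 := (ZMod.natCast_eq_zero_iff _ _).2 h
    push_cast at h1
    exact ZMod.mod_four_ne_three_of_sq_eq_neg_one (p := l) (y := (p : ZMod l) ^ n)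
      (by linear_combination h1) hl4
  have h2S := twoS (GaloisField p (2 * n)) p (2 * n) hF hcardp l
    (by rw [hcard]; exact (Nat.Prime.coprime_iff_not_dvd hl).2 hlp)
  have hq0 : 0 < p ^ n := pow_pos hp.pos n
  have hl1 : 3 ≤ l := by omega
  rw [hc, hcard] at hce
  push_cast [show 1 ≤ l by omega] at hce
  have hA : (∑ t : (GaloisField p (2 * n))ˣ, quadraticChar (GaloisField p (2 * n))
        ((t : GaloisField p (2 * n)) ^ l + ((t : GaloisField p (2 * n)) ^ l)⁻¹) : ℤ) -
      ∑ t : (GaloisField p (2 * n))ˣ, quadraticChar (GaloisField p (2 * n))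
        ((t : GaloisField p (2 * n)) + (t : GaloisField p (2 * n))⁻¹)
      = (2 * l - 2) * ((p ^ n : ℕ) : ℤ) := by
    rw [← h2S]; push_cast; linear_combination -2 * hce
  by_cases hdiv : l ∣ (p ^ n) ^ 2 - 1
  · have h8 : (p ^ n) ^ 2 % 8 = 1 := by
      have : p ^ n % 2 = 1 := by
        rw [Nat.pow_mod, show p % 2 = 1 by omega]; simp
      have h4 : p ^ n % 8 = 1 ∨ p ^ n % 8 = 3 ∨ p ^ n % 8 = 5 ∨ p ^ n % 8 = 7 := by omega
      rw [Nat.pow_mod]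
      rcases h4 with h | h | h | h <;> rw [h]
    have hdiv8 : l * 8 ∣ (p ^ n) ^ 2 - 1 := by
      apply Nat.Coprime.mul_dvd_of_dvd_of_dvd _ hdiv (by omega)
      rw [show 8 = 2 ^ 3 by norm_num]
      apply Nat.Coprime.pow_right
      exact Nat.coprime_two_right.2 (Nat.odd_iff.2 (by omega))
    obtain ⟨w, hw⟩ := hdiv8
    have hm : 4 * l * (2 * w) = (p ^ n) ^ 2 - 1 := by rw [hw]; ring
    obtain ⟨m, hmw⟩ : ∃ m, m = 2 * w := ⟨_, rfl⟩
    rw [← hmw] at hm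
    have hm2 : m % 2 = 0 := by omega
    obtain ⟨T, hT, hval⟩ := val_main (GaloisField p (2 * n)) p n hcard hn
    have hJ := split_case (GaloisField p (2 * n)) hF T hT l m (p ^ n) hcard (by omega) hm2
      (by rw [hcard, hm]) hA
    have hN : 1 < (p ^ n) ^ 2 := by rw [← hcard]; exact Fintype.one_lt_card
    have hm0 : 0 < m := Nat.pos_of_ne_zero (by rintro rfl; omega)
    rw [hcard, ← hm] at hT
    rw [hcard, ← hm] at hval
    have hTN : T ^ (4 * l * m) = 1 := (hT _).2 dvd_rfl
    have hper : ∀ a c, T ^ ((a + 4 * l * c) * m) = T ^ (a * m) := by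
      intro a c
      rw [show (a + 4 * l * c) * m = a * m + 4 * l * m * c by ring, pow_add, pow_mul T (4 * l * m), hTN,
        one_pow, mul_one]
    apply combin l p (2 * n) m hl hl4 hp hp4 (by omega) (by rw [hm, ← hcard, hcardp])
    intro k hk hk4 hlk
    have hquad := quad_eq (GaloisField p (2 * n)) hF T (by rw [hcard, ← hm]; exact hT) (2 * l * m)
      (by rw [hcard, ← hm]; ring)
    obtain ⟨r, hr⟩ : ∃ r, r = (k + 3 * l) % (4 * l) := ⟨_, rfl⟩
    obtain ⟨c, hrc⟩ : ∃ c, c = (k + 3 * l) / (4 * l) := ⟨_, rfl⟩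
    have hdm := Nat.div_add_mod (k + 3 * l) (4 * l)
    rw [← hr, ← hrc] at hdm
    have hrlt : r < 4 * l := by rw [hr]; exact Nat.mod_lt _ (by omega)
    have hc4 : 4 * l * c = 4 * (l * c) := by ring
    have hr4 : r % 2 = 0 := by omega
    have hj := hJ (r / 2) (by omega) ?_ ?_
    · have e : 2 * (r / 2) + l = r + l := by omega
      rw [e] at hj
      have e2 : T ^ ((r + l) * m) = T ^ (k * m) := by
        rw [← hper (r + l) c, ← hper k 1]
        congr 2; omega
      rw [e2] at hj
      obtain ⟨s, hs⟩ : ∃ s, s = (k + 2 * l) % (4 * l) := ⟨_, rfl⟩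
      obtain ⟨d, hd⟩ : ∃ d, d = (k + 2 * l) / (4 * l) := ⟨_, rfl⟩
      have hdm2 := Nat.div_add_mod (k + 2 * l) (4 * l)
      rw [← hs, ← hd] at hdm2
      have hslt : s < 4 * l := by rw [hs]; exact Nat.mod_lt _ (by omega)
      have hd4 : 4 * l * d = 4 * (l * d) := by ring
      rw [← hs]
      refine hval (T ^ (2 * l * m)) ?_ ?_ (k * m) (s * m) ?_ ?_ ?_ ?_ hj
      · intro h
        rw [hT] at h
        have := Nat.le_of_dvd (by positivity) h
        have : 0 < l * m := by positivity
        nlinarith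
      · rw [← hquad]; exact (quadraticChar_isQuadratic _).comp _
      · exact Nat.mul_lt_mul_of_pos_right hk hm0
      · exact Nat.mul_lt_mul_of_pos_right hslt hm0
      · exact Nat.mul_pos (by omega) hm0
      · rw [← pow_add, ← add_mul, ← hper s d]
        congr 2; omega
    · intro h0
      apply hlk
      have : r = 0 := by omega
      have h1 : l ∣ k + 3 * l := by rw [← hdm, this, add_zero, mul_assoc]; exact Dvd.intro (4 * c) (by ring)
      exact (Nat.dvd_add_left (Dvd.intro_left 3 rfl)).1 h1
    · intro h0
      apply hlk
      have : r = 2 * l := by omega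
      have h1 : l ∣ k + 3 * l := by rw [← hdm, this]; exact Dvd.intro (4 * c + 2) (by ring)
      exact (Nat.dvd_add_left (Dvd.intro_left 3 rfl)).1 h1
  · have hcop : Nat.Coprime (Nat.card (GaloisField p (2 * n))ˣ) l := by
      rw [Nat.card_eq_fintype_card, Fintype.card_units, hcard]
      exact ((Nat.Prime.coprime_iff_not_dvd hl).2 hdiv).symm
    have := Equiv.sum_comp (powCoprime hcop) (fun t : (GaloisField p (2 * n))ˣ =>
      quadraticChar (GaloisField p (2 * n)) ((t : GaloisField p (2 * n)) + (t : GaloisField p (2 * n))⁻¹))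
    simp only [powCoprime_apply, Units.val_pow_eq_pow_val] at this
    rw [this, sub_self] at hA
    have h1 : (0 : ℤ) < 2 * l - 2 := by omega
    have h2 : (0 : ℤ) < ((p ^ n : ℕ) : ℤ) := by exact_mod_cast hq0
    have := mul_pos h1 h2
    omega
end

section
/- Let ℓ be a prime with ℓ ≡ 3 (mod 4) and let p ≠ ℓ be a prime with p ≡ 3 (mod 4). Let m be the order of the image of p in the group 𝔽_ℓ^×/{±1}. Then for q = p^n, the curve H_ℓ is maximal over 𝔽_{q²} if and only if n = km with k a positive odd integer. -/
open Polynomial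

set_option linter.all false

section part1

open Finset

variable {F : Type} [Field F] [Fintype F] [DecidableEq F]

lemma cheb_mem_base (K : Type) [Field K] [Algebra F K] (t : K)
    (ht : t ^ Fintype.card F = t) : ∃ r : F, algebraMap F K r = t := by
  classical
  have hne : (X ^ Fintype.card F - X : K[X]) ≠ 0 :=
    FiniteField.X_pow_card_sub_X_ne_zero K Fintype.one_lt_card
  have hsub : (univ : Finset F).image (algebraMap F K) ⊆
      (X ^ Fintype.card F - X : K[X]).roots.toFinset := by
    intro y hy
    obtain ⟨r, -, rfl⟩ := Finset.mem_image.1 hy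
    rw [Multiset.mem_toFinset, mem_roots hne]
    simp [← map_pow, FiniteField.pow_card]
  have hcard : ((X ^ Fintype.card F - X : K[X]).roots.toFinset).card ≤
      ((univ : Finset F).image (algebraMap F K)).card := by
    rw [Finset.card_image_of_injective _ (algebraMap F K).injective, Finset.card_univ]
    refine (Multiset.toFinset_card_le _).trans ((card_roots' _).trans ?_)
    rw [FiniteField.X_pow_card_sub_X_natDegree_eq K Fintype.one_lt_card]
  have heq := Finset.eq_of_subset_of_card_le hsub hcard
  have : t ∈ (univ : Finset F).image (algebraMap F K) := by
    rw [heq, Multiset.mem_toFinset, mem_roots hne]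
    simp [ht]
  obtain ⟨r, -, hr⟩ := Finset.mem_image.1 this
  exact ⟨r, hr⟩

lemma cheb_two_sols {K : Type} [Field K] {a b : K} (ha : a ≠ 0) (hb : b ≠ 0)
    (h : a + a⁻¹ = b + b⁻¹) : a = b ∨ a = b⁻¹ := by
  have : (a - b) * (a - b⁻¹) = 0 := by
    have h1 : a * (a + a⁻¹) = a * (b + b⁻¹) := by rw [h]
    have h2 : a * a⁻¹ = 1 := mul_inv_cancel₀ ha
    have h3 : b * b⁻¹ = 1 := mul_inv_cancel₀ hb
    linear_combination h1 - h2 + h3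
  rcases mul_eq_zero.1 this with h | h
  · left; exact sub_eq_zero.1 h
  · right; exact sub_eq_zero.1 h

lemma cheb_param (x : F) : ∃ t : AlgebraicClosure F, t ≠ 0 ∧
    t + t⁻¹ = algebraMap F _ x := by
  obtain ⟨t, ht⟩ := IsAlgClosed.exists_root
    (X ^ 2 - C (algebraMap F (AlgebraicClosure F) x) * X + 1 : (AlgebraicClosure F)[X])
    (by
      have : (X ^ 2 - C (algebraMap F (AlgebraicClosure F) x) * X + 1 :
        (AlgebraicClosure F)[X]).degree = 2 := by compute_degree!
      rw [this]; decide)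
  have ht' : t ^ 2 - algebraMap F (AlgebraicClosure F) x * t + 1 = 0 := by
    simpa [IsRoot] using ht
  have h0 : t ≠ 0 := by
    rintro rfl
    simp at ht'
  refine ⟨t, h0, ?_⟩
  field_simp
  linear_combination ht'

lemma cheb_frob {x : F} {t : AlgebraicClosure F} (h0 : t ≠ 0)
    (h : t + t⁻¹ = algebraMap F _ x) :
    t ^ Fintype.card F = t ∨ t ^ Fintype.card F = t⁻¹ := by
  apply cheb_two_sols (pow_ne_zero _ h0) h0
  obtain ⟨p, hp⟩ := CharP.exists F
  have := hp
  have : Fact p.Prime := ⟨CharP.char_is_prime F p⟩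
  obtain ⟨n, hpp, hn⟩ := FiniteField.card F p
  have : CharP (AlgebraicClosure F) p := charP_of_injective_algebraMap' F p
  rw [h, ← FiniteField.pow_card x, map_pow, ← h, hn, add_pow_char_pow, inv_pow]

lemma cheb_eval {l : ℕ} {x : F} {t : AlgebraicClosure F} (h0 : t ≠ 0)
    (h : t + t⁻¹ = algebraMap F _ x) :
    algebraMap F (AlgebraicClosure F) ((dickson 1 (1 : F) l).eval x) = t ^ l + (t ^ l)⁻¹ := by
  rw [← inv_pow, ← dickson_one_one_eval_add_inv t t⁻¹ (mul_inv_cancel₀ h0) l, h,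
    ← map_one (algebraMap F (AlgebraicClosure F)), ← map_dickson, eval_map_algebraMap,
    aeval_algebraMap_apply]
  simp

lemma cheb_eq_of_coprime {K : Type} [Field K] {a b : K} {l N : ℕ} (ha : a ≠ 0) (hb : b ≠ 0)
    (hN : Nat.Coprime l N) (haN : a ^ N = 1) (hbN : b ^ N = 1) (h : a ^ l = b ^ l) : a = b := by
  have h1 : (a / b) ^ l = 1 := by rw [div_pow, h, div_self (pow_ne_zero _ hb)]
  have h2 : (a / b) ^ N = 1 := by rw [div_pow, haN, hbN, div_one]
  have h3 : orderOf (a / b) ∣ Nat.gcd l N :=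
    Nat.dvd_gcd (orderOf_dvd_of_pow_eq_one h1) (orderOf_dvd_of_pow_eq_one h2)
  rw [hN] at h3
  have h4 : a / b = 1 := orderOf_eq_one_iff.1 (Nat.dvd_one.1 h3)
  exact (div_eq_one_iff_eq hb).1 h4

lemma cheb_inj_aux {l N : ℕ} (hN : Nat.Coprime l N) {x y : F} {t u : AlgebraicClosure F}
    (t0 : t ≠ 0) (ht : t + t⁻¹ = algebraMap F _ x) (u0 : u ≠ 0)
    (hu : u + u⁻¹ = algebraMap F _ y) (htN : t ^ N = 1) (huN : u ^ N = 1)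
    (h : (dickson 1 (1 : F) l).eval x = (dickson 1 (1 : F) l).eval y) : x = y := by
  apply (algebraMap F (AlgebraicClosure F)).injective
  have h' := congrArg (algebraMap F (AlgebraicClosure F)) h
  rw [cheb_eval t0 ht, cheb_eval u0 hu] at h'
  rw [← ht, ← hu]
  rcases cheb_two_sols (pow_ne_zero _ t0) (pow_ne_zero _ u0) h' with h1 | h1
  · rw [cheb_eq_of_coprime t0 u0 hN htN huN h1]
  · rw [← inv_pow] at h1
    rw [cheb_eq_of_coprime t0 (inv_ne_zero u0) hN htN (by rw [inv_pow, huN, inv_one]) h1, inv_inv,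
      add_comm]

lemma cheb_injective {l : ℕ} (hN : Nat.Coprime l (Fintype.card F ^ 2 - 1)) :
    Function.Injective (fun x : F => (dickson 1 (1 : F) l).eval x) := by
  have key : ∀ (x : F) (t : AlgebraicClosure F), t ≠ 0 → t + t⁻¹ = algebraMap F _ x →
      t ^ (Fintype.card F ^ 2 - 1) = 1 := by
    intro x t t0 ht
    have h2 : t ^ (Fintype.card F ^ 2) = t := by
      rw [pow_two, pow_mul]
      rcases cheb_frob t0 ht with h | h
      · rw [h, h]
      · rw [h, inv_pow, h, inv_inv]
    have h3 : 0 < Fintype.card F ^ 2 := pow_pos Fintype.card_pos 2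
    have h4 : t * t ^ (Fintype.card F ^ 2 - 1) = t * 1 := by
      rw [← pow_succ', Nat.sub_add_cancel h3, h2, mul_one]
    exact mul_left_cancel₀ t0 h4
  intro x y h
  obtain ⟨t, t0, ht⟩ := cheb_param x
  obtain ⟨u, u0, hu⟩ := cheb_param y
  exact cheb_inj_aux hN t0 ht u0 hu (key x t t0 ht) (key y u u0 hu) h

/-- the `x` which are traces of norm one elements -/
def chebB (x : F) : Prop := ∃ t : AlgebraicClosure F, t ≠ 0 ∧ t + t⁻¹ = algebraMap F _ x ∧
  t ^ (Fintype.card F + 1) = 1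


lemma chebB_map {l : ℕ} {x : F} (h : chebB x) : chebB ((dickson 1 (1 : F) l).eval x) := by
  obtain ⟨t, t0, ht, hN⟩ := h
  refine ⟨t ^ l, pow_ne_zero _ t0, (cheb_eval t0 ht).symm, ?_⟩
  rw [← pow_mul, mul_comm, pow_mul, hN, one_pow]


lemma chebB_inj {l : ℕ} (hN : Nat.Coprime l (Fintype.card F + 1)) {x y : F} (hx : chebB x)
    (hy : chebB y) (h : (dickson 1 (1 : F) l).eval x = (dickson 1 (1 : F) l).eval y) : x = y := by
  obtain ⟨t, t0, ht, htN⟩ := hx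
  obtain ⟨u, u0, hu, huN⟩ := hy
  exact cheb_inj_aux hN t0 ht u0 hu htN huN h

lemma chebB_iff (hF : ringChar F ≠ 2) (x : F) :
    chebB x ↔ 1 - quadraticChar F (x ^ 2 - 4) ≠ 0 := by
  have h2 : (2 : F) ≠ 0 := Ring.two_ne_zero hF
  have h4 : ((4 : F)) ≠ 0 := by
    have : (4 : F) = 2 * 2 := by norm_num
    rw [this]; exact mul_ne_zero h2 h2
  constructor
  · rintro ⟨t, t0, ht, hN⟩ h
    have h1 : quadraticChar F (x ^ 2 - 4) = 1 := by linarith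
    have hx : x ^ 2 - 4 ≠ 0 := by
      intro h0
      rw [h0] at h1
      simp at h1
    obtain ⟨w, hw⟩ := (quadraticChar_one_iff_isSquare hx).1 h1
    set r : F := (x + w) / 2 with hr
    have hrr : r * (x - r) = 1 := by
      rw [hr]; field_simp; linear_combination hw
    have r0 : r ≠ 0 := by
      intro h; rw [h] at hrr; simp at hrr
    have hri : r⁻¹ = x - r := (eq_inv_of_mul_eq_one_right hrr).symm
    have hrt : algebraMap F (AlgebraicClosure F) r + (algebraMap F (AlgebraicClosure F) r)⁻¹ =
        t + t⁻¹ := by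
      rw [ht, ← map_inv₀, ← map_add, hri]; congr 1; ring
    have hrr2 : (r ^ 2 : F) = 1 := by
      have hQ : (algebraMap F (AlgebraicClosure F) r) ^ (Fintype.card F + 1) = 1 := by
        rcases cheb_two_sols (by simpa using r0) t0 hrt with h | h
        · rw [h, hN]
        · rw [h, inv_pow, hN, inv_one]
      rw [← map_pow, pow_succ, FiniteField.pow_card, ← pow_two] at hQ
      exact (algebraMap F (AlgebraicClosure F)).injective (by rw [hQ, map_one])
    apply hx
    have hx2 : x = r + r⁻¹ := by rw [hri]; ring
    have hri2 : r⁻¹ = r := by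
      rw [inv_eq_iff_eq_inv]; exact eq_inv_of_mul_eq_one_left (by rw [← pow_two, hrr2])
    rw [hx2, hri2]
    linear_combination 4 * hrr2
  · intro h
    obtain ⟨t, t0, ht⟩ := cheb_param x
    refine ⟨t, t0, ht, ?_⟩
    rcases cheb_frob t0 ht with h1 | h1
    · obtain ⟨r, hr⟩ := cheb_mem_base _ t h1
      have hxr : x = r + r⁻¹ := by
        apply (algebraMap F (AlgebraicClosure F)).injective
        rw [← ht, map_add, map_inv₀, hr]
      have r0 : r ≠ 0 := by
        rintro rfl; apply t0; rw [← hr, map_zero]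
      have hsq : x ^ 2 - 4 = (r - r⁻¹) ^ 2 := by
        rw [hxr]; field_simp; ring
      have : r - r⁻¹ = 0 := by
        by_contra hne
        apply h
        rw [hsq, quadraticChar_sq_one' hne, sub_self]
      have hrr : r * r = 1 := by
        have h5 : r = r⁻¹ := sub_eq_zero.1 this
        nth_rewrite 2 [h5]
        exact mul_inv_cancel₀ r0
      rw [pow_succ, h1, ← hr, ← map_mul, hrr, map_one]
    · rw [pow_succ, h1, inv_mul_cancel₀ t0]

lemma cheb_eval_two (l : ℕ) : (dickson 1 (1 : F) l).eval 2 = 2 := by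
  have := dickson_one_one_eval_add_inv (1 : F) 1 (by simp) l
  norm_num at this
  exact this

lemma cheb_eval_neg_two {l : ℕ} (hl : Odd l) : (dickson 1 (1 : F) l).eval (-2) = -2 := by
  have := dickson_one_one_eval_add_inv (-1 : F) (-1) (by simp) l
  norm_num [hl.neg_one_pow] at this
  exact this

lemma cheb_sum_B (hF : ringChar F ≠ 2) {l : ℕ} (hl : Odd l)
    (hN : Nat.Coprime l (Fintype.card F + 1)) (f : F → ℤ) :
    ∑ x : F, (1 - quadraticChar F (x ^ 2 - 4)) * f ((dickson 1 (1 : F) l).eval x) =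
    ∑ x : F, (1 - quadraticChar F (x ^ 2 - 4)) * f x := by
  classical
  have hval : ∀ x : F, chebB x → quadraticChar F (((dickson 1 (1 : F) l).eval x) ^ 2 - 4) =
      quadraticChar F (x ^ 2 - 4) := by
    have hz : ∀ x : F, chebB x → (x ^ 2 - 4 = 0 ∨ quadraticChar F (x ^ 2 - 4) = -1) := by
      intro x hx
      by_cases h0 : x ^ 2 - 4 = 0
      · exact Or.inl h0
      · right
        have := (chebB_iff hF x).1 hx
        rcases quadraticChar_dichotomy h0 with h | h
        · rw [h] at this; simp at this
        · exact h
    have h4 : ∀ x : F, x ^ 2 - 4 = 0 ↔ (x = 2 ∨ x = -2) := by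
      intro x
      rw [← sq_eq_sq_iff_eq_or_eq_neg, sub_eq_zero]; norm_num
    have hB2 : chebB (2 : F) := by
      rw [chebB_iff hF]; norm_num
    have hB2' : chebB (-2 : F) := by
      rw [chebB_iff hF]; norm_num
    intro x hx
    have hPx := chebB_map (l := l) hx
    have hiff : ((dickson 1 (1 : F) l).eval x) ^ 2 - 4 = 0 ↔ x ^ 2 - 4 = 0 := by
      rw [h4, h4]
      constructor
      · rintro (h | h)
        · left; exact chebB_inj hN hx hB2 (by rw [h, cheb_eval_two])
        · right; exact chebB_inj hN hx hB2' (by rw [h, cheb_eval_neg_two hl])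
      · rintro (rfl | rfl)
        · left; exact cheb_eval_two l
        · right; exact cheb_eval_neg_two hl
    rcases hz x hx with h | h
    · rw [h, hiff.2 h]
    · rcases hz _ hPx with h' | h'
      · rw [h', hiff.1 h']
      · rw [h, h']
  have hred : ∀ g : F → ℤ, ∑ x : F, (1 - quadraticChar F (x ^ 2 - 4)) * g x =
      ∑ x ∈ univ.filter (fun x : F => chebB x), (1 - quadraticChar F (x ^ 2 - 4)) * g x := by
    intro g
    symm
    apply Finset.sum_filter_of_ne
    intro x _ hx
    rw [chebB_iff hF]
    exact left_ne_zero_of_mul hx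
  rw [hred, hred f]
  apply Finset.sum_nbij (fun x => (dickson 1 (1 : F) l).eval x)
  · intro x hx
    simp only [mem_filter, mem_univ, true_and] at hx ⊢
    exact chebB_map hx
  · intro x hx y hy h
    simp only [coe_filter, mem_univ, true_and, Set.mem_ofPred_eq] at hx hy
    exact chebB_inj hN hx hy h
  · apply Finset.surjOn_of_injOn_of_card_le _ _ _ le_rfl
    · intro x hx
      simp only [coe_filter, mem_univ, true_and, Set.mem_ofPred_eq] at hx ⊢
      exact chebB_map hx
    · intro x hx y hy h
      simp only [coe_filter, mem_univ, true_and, Set.mem_ofPred_eq] at hx hy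
      exact chebB_inj hN hx hy h
  · intro x hx
    simp only [mem_filter, mem_univ, true_and] at hx
    rw [hval x hx]

lemma cheb_sum_torus (hF : ringChar F ≠ 2) (f : F → ℤ) :
    ∑ t ∈ univ.filter (fun t : F => t ≠ 0), f (t + t⁻¹) =
    ∑ x : F, (1 + quadraticChar F (x ^ 2 - 4)) * f x := by
  have h2 : (2 : F) ≠ 0 := Ring.two_ne_zero hF
  rw [← Finset.sum_fiberwise (univ.filter (fun t : F => t ≠ 0)) (fun t => t + t⁻¹)]
  apply Finset.sum_congr rfl
  intro x _
  have h1 : ∑ t ∈ (univ.filter (fun t : F => t ≠ 0)).filter (fun t => t + t⁻¹ = x),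
      f (t + t⁻¹) = ∑ t ∈ (univ.filter (fun t : F => t ≠ 0)).filter (fun t => t + t⁻¹ = x), f x := by
    apply Finset.sum_congr rfl
    intro t ht
    rw [(Finset.mem_filter.1 ht).2]
  rw [h1, Finset.sum_const, nsmul_eq_mul]
  congr 1
  rw [add_comm, ← quadraticChar_card_sqrts hF]
  congr 1
  apply Finset.card_bij' (fun t _ => 2 * t - x) (fun w _ => (w + x) / 2)
  · intro t ht
    simp only [mem_filter, mem_univ, true_and] at ht
    obtain ⟨t0, ht⟩ := ht
    simp only [Set.mem_toFinset, Set.mem_ofPred_eq]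
    rw [← ht]; field_simp; ring
  · intro w hw
    simp only [Set.mem_toFinset, Set.mem_ofPred_eq] at hw
    have hm : ((w + x) / 2) * ((x - w) / 2) = 1 := by
      field_simp; linear_combination -hw
    have h0 : (w + x) / 2 ≠ 0 := left_ne_zero_of_mul (by rw [hm]; exact one_ne_zero)
    simp only [mem_filter, mem_univ, true_and]
    refine ⟨h0, ?_⟩
    rw [← eq_inv_of_mul_eq_one_right hm]
    field_simp; ring
  · intro t _
    field_simp; ring
  · intro w _
    field_simp; ring

/-- torus sum -/
def chebT (F : Type) [Field F] [Fintype F] [DecidableEq F] (l : ℕ) : ℤ :=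
  ∑ t : F, quadraticChar F t * quadraticChar F (t ^ (2 * l) + 1)

lemma chebT_eq (hF : ringChar F ≠ 2) {l : ℕ} (hl : Odd l) :
    chebT F l = ∑ x : F, (1 + quadraticChar F (x ^ 2 - 4)) *
      quadraticChar F ((dickson 1 (1 : F) l).eval x) := by
  rw [← cheb_sum_torus hF (fun x => quadraticChar F ((dickson 1 (1 : F) l).eval x)), chebT,
    Finset.sum_filter]
  apply Finset.sum_congr rfl
  intro t _
  split_ifs with h
  · rw [dickson_one_one_eval_add_inv t t⁻¹ (mul_inv_cancel₀ h) l]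
    have h1 : t ^ (2 * l) + 1 = t ^ l * (t ^ l + t⁻¹ ^ l) := by
      have h3 : t ^ l * t⁻¹ ^ l = 1 := by rw [← mul_pow, mul_inv_cancel₀ h, one_pow]
      rw [mul_add, h3]; ring
    have h2 : quadraticChar F t ^ 2 = 1 := quadraticChar_sq_one h
    obtain ⟨k, rfl⟩ := hl
    rw [h1, map_mul, map_pow, ← mul_assoc, ← pow_succ',
      show 2 * k + 1 + 1 = 2 * (k + 1) by ring, pow_mul, h2, one_pow, one_mul]
  · simp at h
    simp [h]

lemma cheb_two_S (hF : ringChar F ≠ 2) {l : ℕ} (hl : Odd l)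
    (hN : Nat.Coprime l (Fintype.card F + 1)) :
    2 * ∑ x : F, quadraticChar F ((dickson 1 (1 : F) l).eval x) = chebT F l - chebT F 1 := by
  have h1 := cheb_sum_B hF hl hN (fun x => quadraticChar F x)
  have h2 := chebT_eq (F := F) hF hl
  have h3 := chebT_eq (F := F) hF odd_one
  have h4 := quadraticChar_sum_zero hF
  simp only [dickson_one, eval_X] at h3
  simp only [sub_mul, add_mul, one_mul, Finset.sum_sub_distrib, Finset.sum_add_distrib] at h1 h2 h3
  linarith

lemma cheb_count (hF : ringChar F ≠ 2) (l : ℕ) :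
    (chebAffineCount F l : ℤ) = Fintype.card F +
      ∑ x : F, quadraticChar F ((dickson 1 (1 : F) l).eval x) := by
  have h1 : chebAffineCount F l =
      ∑ x : F, ({y : F | y ^ 2 = (dickson 1 (1 : F) l).eval x}.toFinset).card := by
    rw [chebAffineCount, Nat.card_eq_fintype_card, Fintype.card_subtype]
    rw [Finset.card_eq_sum_card_fiberwise (f := fun xy : F × F => xy.1) (t := univ)
      (by intro a _; simp)]
    apply Finset.sum_congr rfl
    intro x _
    refine Finset.card_bij' (fun xy _ => xy.2) (fun y _ => (x, y)) ?_ ?_ ?_ ?_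
    · intro a ha
      simp at ha ⊢
      rw [ha.1, ha.2]
    · intro a ha
      simpa using ha
    · intro a ha
      simp at ha
      ext
      · exact ha.2.symm
      · rfl
    · intro a ha
      rfl
  rw [h1]
  push_cast
  simp_rw [quadraticChar_card_sqrts hF]
  rw [Finset.sum_add_distrib]
  simp [add_comm]

lemma cheb_sum_perm (hF : ringChar F ≠ 2) {l : ℕ}
    (hN : Nat.Coprime l (Fintype.card F ^ 2 - 1)) :
    ∑ x : F, quadraticChar F ((dickson 1 (1 : F) l).eval x) = 0 := by
  have hb := Finite.injective_iff_bijective.1 (cheb_injective (F := F) hN)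
  rw [← quadraticChar_sum_zero hF]
  exact hb.sum_comp (fun x => quadraticChar F x)

end part1

section part2

open Finset

variable {F : Type} [Field F] [Fintype F] [DecidableEq F]

lemma cheb_exists_addChar (p : ℕ) [hp : Fact p.Prime] [CharP F p] :
    ∃ e : AddChar F ℂ, e.IsPrimitive ∧ ∀ x, e (x ^ p) = e x := by
  obtain rfl : p = ringChar F := (ringChar.eq F p).symm
  letI : Algebra (ZMod (ringChar F)) F := ZMod.algebra F _
  haveI : NeZero (ringChar F) := ⟨hp.out.ne_zero⟩
  refine ⟨(ZMod.stdAddChar : AddChar (ZMod (ringChar F)) ℂ).compAddMonoidHom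
    (Algebra.trace (ZMod (ringChar F)) F).toAddMonoidHom, ?_, ?_⟩
  · apply AddChar.IsPrimitive.of_ne_one
    rw [AddChar.ne_one_iff]
    obtain ⟨b, hb⟩ := FiniteField.trace_to_zmod_nondegenerate F (one_ne_zero (α := F))
    refine ⟨b, fun h => hb ?_⟩
    rw [one_mul]
    apply ZMod.injective_stdAddChar
    rw [AddChar.map_zero_eq_one]
    exact h
  · intro x
    have h := Algebra.trace_eq_of_algEquiv
      (FiniteField.frobeniusAlgEquivOfAlgebraic (ZMod (ringChar F)) F) x
    rw [FiniteField.coe_frobeniusAlgEquivOfAlgebraic] at h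
    simp only [ZMod.card] at h
    change ZMod.stdAddChar (Algebra.trace (ZMod (ringChar F)) F (x ^ ringChar F)) =
      ZMod.stdAddChar (Algebra.trace (ZMod (ringChar F)) F x)
    rw [h]

lemma cheb_e_pow {p : ℕ} {e : AddChar F ℂ} (he : ∀ x, e (x ^ p) = e x) (k : ℕ) (x : F) :
    e (x ^ p ^ k) = e x := by
  induction k with
  | zero => simp
  | succ k ih => rw [pow_succ, pow_mul, he, ih]

lemma cheb_gauss_frob {p : ℕ} [hp : Fact p.Prime] [CharP F p] {e : AddChar F ℂ}
    (he : ∀ x, e (x ^ p) = e x) (k : ℕ) (ν : MulChar F ℂ) :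
    gaussSum (ν ^ p ^ k) e = gaussSum ν e := by
  have hb : Function.Bijective (fun x : F => x ^ p ^ k) := by
    apply Finite.injective_iff_bijective.1
    exact iterateFrobenius_inj F p k
  unfold gaussSum
  rw [← hb.sum_comp (fun x => ν x * e x)]
  apply Finset.sum_congr rfl
  intro x _
  rw [cheb_e_pow he, MulChar.pow_apply' _ (pow_ne_zero _ hp.out.ne_zero), map_pow]

lemma cheb_generator {q : ℕ} (hq : 1 < q) (hQ : Fintype.card F = q ^ 2) :
    ∃ g : Fˣ, (∀ x, x ∈ Subgroup.zpowers g) ∧ orderOf g = (q - 1) * (q + 1) := by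
  obtain ⟨g, hg⟩ := IsCyclic.exists_generator (α := Fˣ)
  refine ⟨g, hg, ?_⟩
  rw [orderOf_eq_card_of_forall_mem_zpowers hg, Nat.card_eq_fintype_card, Fintype.card_units, hQ]
  obtain ⟨k, rfl⟩ := Nat.exists_eq_add_of_lt hq
  have : (1 + k + 1) ^ 2 = (1 + k + 1 - 1) * (1 + k + 1 + 1) + 1 := by
    simp; ring
  omega

lemma cheb_R_pow {q : ℕ} (hq : 1 < q) (hQ : Fintype.card F = q ^ 2) {r : F} (h0 : r ≠ 0)
    (hr : r ^ q = r) : ∃ y : F, y ≠ 0 ∧ r = y ^ (q + 1) := by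
  obtain ⟨g, hg, hord⟩ := cheb_generator hq hQ
  obtain ⟨k, hk⟩ := (mem_powers_iff_mem_zpowers).2 (hg (Units.mk0 r h0))
  have hk' : g ^ k = Units.mk0 r h0 := hk
  have h1 : (Units.mk0 r h0) ^ (q - 1) = 1 := by
    have : (Units.mk0 r h0) * (Units.mk0 r h0) ^ (q - 1) = Units.mk0 r h0 * 1 := by
      rw [← pow_succ', Nat.sub_add_cancel hq.le]
      ext; simp [hr]
    exact mul_left_cancel this
  rw [← hk', ← pow_mul] at h1
  have h2 := orderOf_dvd_of_pow_eq_one h1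
  rw [hord, mul_comm k] at h2
  obtain ⟨j, rfl⟩ := Nat.dvd_of_mul_dvd_mul_left (by omega) h2
  refine ⟨(g ^ j : Fˣ), Units.ne_zero _, ?_⟩
  have h3 := congrArg Units.val hk'
  simp only [Units.val_pow_eq_pow_val, Units.val_mk0] at h3 ⊢
  rw [← h3, ← pow_mul, mul_comm]

lemma cheb_card_pow_eq {d : ℕ} (hd0 : 0 < d) (hd : d ∣ Fintype.card F - 1) {a : F} (ha : a ≠ 0) :
    (univ.filter (fun t : F => t ^ d = a ^ d)).card = d := by
  have h1 := IsCyclic.card_powMonoidHom_ker (G := Fˣ) d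
  rw [Nat.card_eq_fintype_card (α := Fˣ), Fintype.card_units, Nat.gcd_eq_right hd] at h1
  refine Eq.trans ?_ h1
  rw [Nat.card_eq_fintype_card, ← Fintype.card_coe]
  symm
  apply Fintype.card_congr
  refine Equiv.ofBijective (fun u => ⟨a * (u.1 : F), ?_⟩) ⟨?_, ?_⟩
  · have h2 : (u.1 : Fˣ) ^ d = 1 := u.2
    have h3 := congrArg Units.val h2
    simp only [Units.val_pow_eq_pow_val, Units.val_one] at h3
    simp [mul_pow, h3]
  · intro u v h
    simp only [Subtype.mk.injEq] at h
    apply Subtype.ext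
    apply Units.ext
    exact mul_left_cancel₀ ha h
  · rintro ⟨t, ht⟩
    simp only [mem_filter, mem_univ, true_and] at ht
    have t0 : t ≠ 0 := by
      rintro rfl
      rw [zero_pow hd0.ne'] at ht
      exact pow_ne_zero d ha ht.symm
    refine ⟨⟨Units.mk0 (t / a) (div_ne_zero t0 ha), ?_⟩, ?_⟩
    · change (Units.mk0 (t / a) (div_ne_zero t0 ha)) ^ d = 1
      ext
      simp [div_pow, ht, ha]
    · simp; field_simp

lemma cheb_card_R {q : ℕ} (hq : 1 < q) (hQ : Fintype.card F = q ^ 2) :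
    (univ.filter (fun r : F => r ^ q = r)).card = q := by
  have h1 := cheb_card_pow_eq (F := F) (d := q - 1) (by omega)
    (by rw [hQ]; exact ⟨q + 1, by
          obtain ⟨k, rfl⟩ := Nat.exists_eq_add_of_lt hq
          have : (1 + k + 1) ^ 2 = (1 + k + 1 - 1) * (1 + k + 1 + 1) + 1 := by
            simp; ring
          omega⟩) (one_ne_zero)
  have h2 : univ.filter (fun r : F => r ^ q = r) =
      insert 0 (univ.filter (fun t : F => t ^ (q - 1) = 1 ^ (q - 1))) := by
    ext r
    simp only [mem_filter, mem_univ, true_and, mem_insert, one_pow]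
    constructor
    · intro h
      by_cases h0 : r = 0
      · exact Or.inl h0
      · right
        have : r * r ^ (q - 1) = r * 1 := by
          rw [← pow_succ', Nat.sub_add_cancel hq.le, h, mul_one]
        exact mul_left_cancel₀ h0 this
    · rintro (rfl | h)
      · rw [zero_pow (by omega)]
      · rw [← Nat.sub_add_cancel hq.le, pow_succ, h, one_mul]
  rw [h2, card_insert_of_notMem, h1]
  · omega
  · simp only [mem_filter, mem_univ, true_and, one_pow]
    rw [zero_pow (by omega)]
    exact zero_ne_one

lemma cheb_exists_s0 {q : ℕ} (hq : 1 < q) (hodd : Odd q) (hQ : Fintype.card F = q ^ 2) :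
    ∃ s : F, s ≠ 0 ∧ s ^ q = -s := by
  obtain ⟨g, hg, hord⟩ := cheb_generator hq hQ
  obtain ⟨k, hk⟩ := hodd
  have hk0 : 0 < k := by omega
  refine ⟨(g ^ (k + 1) : Fˣ), Units.ne_zero _, ?_⟩
  have h1 : ((g ^ (k + 1) : Fˣ) : F) ^ (q - 1) = -1 := by
    have h2 : (((g ^ (k + 1) : Fˣ) : F) ^ (q - 1)) ^ 2 = 1 := by
      have h3 : ((g ^ (k + 1) : Fˣ) ^ (q - 1)) ^ 2 = 1 := by
        rw [← pow_mul, ← pow_mul, ← pow_orderOf_eq_one g, hord]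
        congr 1
        rw [hk]; simp; ring
      have h4 := congrArg Units.val h3
      simpa using h4
    rcases (sq_eq_sq_iff_eq_or_eq_neg.1 (h2.trans (one_pow 2).symm)) with h | h
    · exfalso
      have h3 : (g ^ ((k + 1) * (q - 1)) : Fˣ) = 1 := by
        ext
        rw [pow_mul]
        simpa using h
      have h4 := Nat.le_of_dvd (by
        apply Nat.mul_pos <;> omega) (orderOf_dvd_of_pow_eq_one h3)
      rw [hord, hk, Nat.add_sub_cancel] at h4
      nlinarith
    · exact h
  conv_lhs => rw [← Nat.sub_add_cancel hq.le, pow_succ, h1]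
  ring

/-- pure Gauss sums -/
lemma cheb_gauss_pure {p n q : ℕ} [hp : Fact p.Prime] [CharP F p] (hp2 : p ≠ 2) (hn : 0 < n)
    (hqn : q = p ^ n)
    (hQ : Fintype.card F = q ^ 2) {e : AddChar F ℂ} (hprim : e.IsPrimitive)
    (he : ∀ x, e (x ^ p) = e x) {s : F} (s0 : s ≠ 0) (hs : s ^ q = -s)
    {ν : MulChar F ℂ} (hν : ν ≠ 1) (hνq : ν ^ (q + 1) = 1) :
    gaussSum ν e = q * ν s := by
  have hq : 1 < q := by rw [hqn]; exact Nat.one_lt_pow hn.ne' hp.out.one_lt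
  set R := univ.filter (fun r : F => r ^ q = r) with hR
  have hRcard : R.card = q := cheb_card_R hq hQ
  have memR : ∀ r, r ∈ R ↔ r ^ q = r := by intro r; simp [hR]
  have addR : ∀ a b, a ∈ R → b ∈ R → a + b ∈ R := by
    intro a b ha hb
    rw [memR] at *
    rw [hqn] at *
    rw [add_pow_char_pow, ha, hb]
  have negR : ∀ a, a ∈ R → -a ∈ R := by
    intro a ha
    rw [memR] at *
    have : Odd q := by rw [hqn]; exact (hp.out.odd_of_ne_two hp2).pow
    rw [this.neg_pow, ha]
  have zR : (0 : F) ∈ R := by rw [memR]; exact zero_pow (by omega)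
  have νR : ∀ r ∈ R, r ≠ 0 → ν r = 1 := by
    intro r hr h0
    obtain ⟨y, hy, rfl⟩ := cheb_R_pow hq hQ h0 ((memR r).1 hr)
    rw [map_pow, ← MulChar.pow_apply' _ (by omega), hνq, MulChar.one_apply hy.isUnit]
  have e2 : ∀ y : F, y ^ q = -y → e y = 1 := by
    intro y hy
    have h2 : (2 : F) ≠ 0 := Ring.two_ne_zero (by rw [ringChar.eq F p]; exact hp2)
    have hy2 : (y / 2) ^ q = -(y / 2) := by
      rw [div_pow, hy]
      have : (2 : F) ^ q = 2 := by
        rw [hqn]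
        have h22 : (2 : F) = 1 + 1 := by norm_num
        rw [h22, add_pow_char_pow, one_pow]
      rw [this, neg_div]
    have h1 : e (y / 2) = e (-(y / 2)) := by
      rw [← hy2, hqn, cheb_e_pow he]
    have h3 : y = y / 2 + y / 2 := by field_simp; ring
    rw [h3, AddChar.map_add_eq_mul]
    nth_rewrite 1 [h1]
    rw [← AddChar.map_add_eq_mul, neg_add_cancel, AddChar.map_zero_eq_one]
  set Z := univ.filter (fun x : F => ∀ r ∈ R, e (x * r) = 1) with hZ
  have sumR : ∀ x, ∑ r ∈ R, e (x * r) = if x ∈ Z then (q : ℂ) else 0 := by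
    intro x
    split_ifs with h
    · have h' : ∀ r ∈ R, e (x * r) = 1 := (Finset.mem_filter.1 h).2
      rw [Finset.sum_congr rfl h', Finset.sum_const, hRcard]
      simp
    · have h' : ∃ r ∈ R, e (x * r) ≠ 1 := by
        by_contra hcon
        push Not at hcon
        exact h (Finset.mem_filter.2 ⟨mem_univ _, hcon⟩)
      obtain ⟨r0, hr0, hne⟩ := h'
      have hmul : e (x * r0) * ∑ r ∈ R, e (x * r) = ∑ r ∈ R, e (x * r) := by
        rw [Finset.mul_sum]
        refine Finset.sum_bij' (fun r _ => r + r0) (fun r _ => r + -r0) ?_ ?_ ?_ ?_ ?_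
        · intro a ha; exact addR _ _ ha hr0
        · intro a ha; exact addR _ _ ha (negR _ hr0)
        · intro a _; ring
        · intro a _; ring
        · intro a _
          rw [mul_add, AddChar.map_add_eq_mul, mul_comm]
      have h5 : (e (x * r0) - 1) * ∑ r ∈ R, e (x * r) = 0 := by
        rw [sub_mul, hmul, one_mul, sub_self]
      rcases mul_eq_zero.1 h5 with h6 | h6
      · exact absurd (sub_eq_zero.1 h6) hne
      · exact h6
  have hqC : (q : ℂ) ≠ 0 := by
    exact_mod_cast (by omega : q ≠ 0)
  have cardZ : Z.card = q := by
    have h1 : ∑ x : F, ∑ r ∈ R, e (x * r) = (q : ℂ) ^ 2 := by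
      rw [Finset.sum_comm]
      simp_rw [AddChar.sum_mulShift _ hprim]
      rw [Finset.sum_eq_single_of_mem 0 zR]
      · simp [hQ]
      · intro b _ hb
        simp [hb]
    simp_rw [sumR] at h1
    rw [← Finset.sum_filter, Finset.sum_const, nsmul_eq_mul] at h1
    have h2 : univ.filter (fun x => x ∈ Z) = Z := by ext; simp
    rw [h2, pow_two] at h1
    exact_mod_cast mul_right_cancel₀ hqC h1
  have imZ : R.image (fun r => s * r) = Z := by
    apply Finset.eq_of_subset_of_card_le
    · intro y hy
      obtain ⟨r, hr, rfl⟩ := Finset.mem_image.1 hy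
      rw [hZ, Finset.mem_filter]
      refine ⟨mem_univ _, fun r' hr' => e2 _ ?_⟩
      rw [mul_pow, mul_pow, hs, (memR r).1 hr, (memR r').1 hr']
      ring
    · rw [cardZ, Finset.card_image_of_injective, hRcard]
      exact mul_right_injective₀ s0
  have cardR' : ∑ r ∈ R, ν r = (q : ℂ) - 1 := by
    rw [← Finset.add_sum_erase _ _ zR, MulChar.map_zero, Finset.sum_congr rfl (g := fun _ => (1 : ℂ)), Finset.sum_const,
      Finset.card_erase_of_mem zR, hRcard]
    · simp [Nat.cast_sub hq.le]
    · intro r hr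
      exact νR r (Finset.mem_of_mem_erase hr) (Finset.ne_of_mem_erase hr)
  have lhs : ∑ r ∈ R, ∑ x : F, ν x * e (x * r) = ((q : ℂ) - 1) * gaussSum ν e := by
    have h1 : ∀ r ∈ R, ∑ x : F, ν x * e (x * r) = ν r * gaussSum ν e := by
      intro r hr
      by_cases h0 : r = 0
      · subst h0
        simp [MulChar.sum_eq_zero_of_ne_one hν, MulChar.map_zero]
      · rw [νR r hr h0, one_mul, gaussSum]
        rw [← (mulRight_bijective₀ r h0).sum_comp (fun x => ν x * e x)]
        apply Finset.sum_congr rfl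
        intro x _
        rw [map_mul ν, νR r hr h0, mul_one]
    rw [Finset.sum_congr rfl h1, ← Finset.sum_mul, cardR']
  have rhs : ∑ r ∈ R, ∑ x : F, ν x * e (x * r) = ((q : ℂ) - 1) * (q * ν s) := by
    rw [Finset.sum_comm]
    simp_rw [← Finset.mul_sum, sumR, mul_ite, mul_zero]
    rw [← Finset.sum_filter]
    have h2 : univ.filter (fun x => x ∈ Z) = Z := by ext; simp
    rw [h2, ← imZ, Finset.sum_image (by
      intro a _ b _ h
      exact mul_right_injective₀ s0 h)]
    simp_rw [map_mul]
    rw [← Finset.sum_mul, ← Finset.mul_sum, cardR']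
    ring
  have hq1 : (q : ℂ) - 1 ≠ 0 := by
    rw [sub_ne_zero]
    exact_mod_cast hq.ne'
  exact mul_left_cancel₀ hq1 (lhs.symm.trans rhs)

end part2

section part3

open Finset

variable {F : Type} [Field F] [Fintype F] [DecidableEq F]

/-- complex valued quadratic character -/
noncomputable def chebChi (F : Type) [Field F] [Fintype F] [DecidableEq F] : MulChar F ℂ :=
  (quadraticChar F).ringHomComp (Int.castRingHom ℂ)

lemma chebChi_apply (x : F) : chebChi F x = ((quadraticChar F x : ℤ) : ℂ) := rfl

lemma chebChi_ne_one (hF : ringChar F ≠ 2) : chebChi F ≠ 1 :=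
  (MulChar.ringHomComp_ne_one_iff (RingHom.injective_int _)).2 (quadraticChar_ne_one hF)

lemma chebChi_sq : chebChi F ^ 2 = 1 :=
  ((quadraticChar_isQuadratic F).comp _).sq_eq_one

lemma cheb_quad_unique {A B : MulChar F ℂ} (hA : A ≠ 1) (hA2 : A ^ 2 = 1) (hB : B ≠ 1)
    (hB2 : B ^ 2 = 1) : A = B := by
  obtain ⟨g, hg⟩ := IsCyclic.exists_generator (α := Fˣ)
  have key : ∀ C : MulChar F ℂ, C ≠ 1 → C ^ 2 = 1 → C g.val = -1 := by
    intro C hC hC2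
    have h1 : C g.val ≠ 1 := by
      intro h
      apply hC
      rw [MulChar.eq_iff hg, h, MulChar.one_apply_coe]
    have h2 : C g.val ^ 2 = 1 := by
      rw [← MulChar.pow_apply_coe, hC2, MulChar.one_apply_coe]
    rcases sq_eq_sq_iff_eq_or_eq_neg.1 (h2.trans (one_pow 2).symm) with h | h
    · exact absurd h h1
    · exact h
  rw [MulChar.eq_iff hg, key A hA hA2, key B hB hB2]

lemma cheb_sum_sq (hF : ringChar F ≠ 2) (h : F → ℂ) :
    ∑ s : F, h (s ^ 2) = ∑ v : F, (1 + chebChi F v) * h v := by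
  rw [← Finset.sum_fiberwise univ (fun s : F => s ^ 2)]
  apply Finset.sum_congr rfl
  intro v _
  have h1 : ∑ s ∈ univ.filter (fun s : F => s ^ 2 = v), h (s ^ 2) =
      ∑ s ∈ univ.filter (fun s : F => s ^ 2 = v), h v := by
    apply Finset.sum_congr rfl
    intro t ht
    rw [(Finset.mem_filter.1 ht).2]
  rw [h1, Finset.sum_const, nsmul_eq_mul]
  congr 1
  have h2 := quadraticChar_card_sqrts hF v
  have h3 : {x : F | x ^ 2 = v}.toFinset = univ.filter (fun s : F => s ^ 2 = v) := by
    ext; simp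
  rw [h3] at h2
  rw [chebChi_apply, add_comm]
  exact_mod_cast h2

lemma cheb_inner (hF : ringChar F ≠ 2) {ν : MulChar F ℂ} (hν : ν (-1) = 1)
    (hχ : chebChi F (-1) = 1) :
    ∑ s : F, ν (s ^ 2) * chebChi F (s ^ 2 + 1) =
      jacobiSum ν (chebChi F) + jacobiSum (ν * chebChi F) (chebChi F) := by
  rw [cheb_sum_sq hF (fun v => ν v * chebChi F (v + 1))]
  unfold jacobiSum
  rw [← Finset.sum_add_distrib, ← Equiv.sum_comp (Equiv.neg F)]
  apply Finset.sum_congr rfl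
  intro v _
  have h1 : ∀ μ : MulChar F ℂ, μ (-1) = 1 → μ (-v) = μ v := by
    intro μ h
    rw [← neg_one_mul, map_mul, h, one_mul]
  simp only [Equiv.neg_apply, MulChar.mul_apply, h1 _ hν, h1 _ hχ]
  rw [show -v + 1 = 1 - v by ring]
  ring

lemma chebT_fiber {l : ℕ} (hl : Odd l) :
    chebT F l = ∑ s : F, ((univ.filter (fun t : F => t ^ l = s)).card : ℤ) *
      (quadraticChar F s * quadraticChar F (s ^ 2 + 1)) := by
  unfold chebT
  rw [← Finset.sum_fiberwise univ (fun t : F => t ^ l)]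
  apply Finset.sum_congr rfl
  intro s _
  rw [← nsmul_eq_mul, ← Finset.sum_const]
  apply Finset.sum_congr rfl
  intro t ht
  have hts := (Finset.mem_filter.1 ht).2
  rw [← hts, ← pow_mul, mul_comm l 2]
  congr 1
  by_cases h0 : t = 0
  · rw [h0, zero_pow (by rintro rfl; simp at hl)]
  · obtain ⟨k, rfl⟩ := hl
    rw [map_pow, pow_succ, pow_mul, quadraticChar_sq_one h0, one_pow, one_mul]

lemma chebT_dvd {l : ℕ} (hl : Odd l) (hd : l ∣ Fintype.card F - 1) : (l : ℤ) ∣ chebT F l := by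
  rw [chebT_fiber hl]
  apply Finset.dvd_sum
  intro s _
  by_cases hs : s = 0
  · simp [hs]
  apply Dvd.dvd.mul_right
  by_cases hex : ∃ a : F, a ^ l = s
  · obtain ⟨a, rfl⟩ := hex
    have ha : a ≠ 0 := by
      rintro rfl
      exact hs (zero_pow hl.pos.ne')
    rw [cheb_card_pow_eq hl.pos hd ha]
  · have : univ.filter (fun t : F => t ^ l = s) = ∅ := by
      ext t
      simp only [mem_filter, mem_univ, true_and, notMem_empty, iff_false]
      exact fun h => hex ⟨t, h⟩
    rw [this]; simp

lemma cheb_orth {l : ℕ} (hl : Odd l) (hd : l ∣ Fintype.card F - 1) {ψ : MulChar F ℂ}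
    (hψ : orderOf ψ = l) {s : F} (hs : s ≠ 0) :
    ((univ.filter (fun t : F => t ^ l = s)).card : ℂ) = ∑ j ∈ range l, (ψ ^ j) (s ^ 2) := by
  have hψl : ψ ^ l = 1 := by rw [← hψ, pow_orderOf_eq_one]
  have hpa : ∀ (j : ℕ) (a : F), a ≠ 0 → (ψ ^ j) a = ψ a ^ j := by
    intro j a ha
    exact MulChar.pow_apply_coe ψ j (Units.mk0 a ha)
  have h1 : ∀ a : F, a ≠ 0 → ψ a ^ l = 1 := by
    intro a ha
    rw [← hpa l a ha, hψl, MulChar.one_apply ha.isUnit]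
  by_cases hex : ∃ a : F, a ^ l = s
  · obtain ⟨a, rfl⟩ := hex
    have ha : a ≠ 0 := by
      rintro rfl
      exact hs (zero_pow hl.pos.ne')
    rw [cheb_card_pow_eq hl.pos hd ha, Finset.sum_congr rfl (g := fun _ => (1 : ℂ))]
    · simp
    · intro j _
      rw [hpa _ _ (pow_ne_zero _ hs), map_pow, map_pow, h1 a ha, one_pow, one_pow]
  · have : univ.filter (fun t : F => t ^ l = s) = ∅ := by
      ext t
      simp only [mem_filter, mem_univ, true_and, notMem_empty, iff_false]
      exact fun h => hex ⟨t, h⟩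
    rw [this]
    have hne : ψ (s ^ 2) ≠ 1 := by
      intro h2
      apply hex
      have h3 : ψ s = 1 := by
        obtain ⟨k, hk⟩ := hl
        have h4 := h1 s hs
        rw [map_pow] at h2
        rw [hk, pow_succ, pow_mul, h2, one_pow, one_mul] at h4
        exact h4
      obtain ⟨g, hg⟩ := IsCyclic.exists_generator (α := Fˣ)
      obtain ⟨k, hk⟩ := (mem_powers_iff_mem_zpowers).2 (hg (Units.mk0 s hs))
      have hk' : g ^ k = Units.mk0 s hs := hk
      have hks : (g.val) ^ k = s := by
        have := congrArg Units.val hk'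
        simpa using this
      have h5 : ψ ^ k = 1 := by
        rw [MulChar.eq_iff hg, MulChar.pow_apply_coe, ← map_pow, hks, h3, MulChar.one_apply_coe]
      have h6 := orderOf_dvd_of_pow_eq_one h5
      rw [hψ] at h6
      obtain ⟨m, rfl⟩ := h6
      exact ⟨g.val ^ m, by rw [← pow_mul, mul_comm, hks]⟩
    have hgeo : (∑ j ∈ range l, ψ (s ^ 2) ^ j) * (ψ (s ^ 2) - 1) = 0 := by
      rw [geom_sum_mul, h1 _ (pow_ne_zero _ hs), sub_self]
    have h7 : ∑ j ∈ range l, (ψ ^ j) (s ^ 2) = ∑ j ∈ range l, ψ (s ^ 2) ^ j :=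
      Finset.sum_congr rfl (fun j _ => hpa j _ (pow_ne_zero _ hs))
    rw [h7]
    rcases mul_eq_zero.1 hgeo with h | h
    · rw [h]; simp
    · exact absurd (sub_eq_zero.1 h) hne

lemma chebT_formula (hF : ringChar F ≠ 2) {l : ℕ} (hl : Odd l) (hd : l ∣ Fintype.card F - 1)
    {ψ ω : MulChar F ℂ} (hψ : orderOf ψ = l) (hω : ω ^ 2 = chebChi F)
    (hω1 : ω (-1) = 1) (hχ1 : chebChi F (-1) = 1) :
    (chebT F l : ℂ) = ∑ j ∈ range l, (jacobiSum (ψ ^ j * ω) (chebChi F) +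
      jacobiSum (ψ ^ j * ω * chebChi F) (chebChi F)) := by
  have hψl : ψ ^ l = 1 := by rw [← hψ, pow_orderOf_eq_one]
  have h1 : ∀ j ∈ range l, jacobiSum (ψ ^ j * ω) (chebChi F) +
      jacobiSum (ψ ^ j * ω * chebChi F) (chebChi F) =
      ∑ s : F, (ψ ^ j * ω) (s ^ 2) * chebChi F (s ^ 2 + 1) := by
    intro j _
    rw [cheb_inner hF _ hχ1]
    rw [MulChar.mul_apply, hω1, mul_one]
    apply MulChar.val_neg_one_eq_one_of_odd_order hl
    rw [← pow_mul, mul_comm, pow_mul, hψl, one_pow]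
  rw [Finset.sum_congr rfl h1, Finset.sum_comm, chebT_fiber hl]
  push_cast
  apply Finset.sum_congr rfl
  intro s _
  by_cases hs : s = 0
  · simp [hs, MulChar.map_zero]
  rw [cheb_orth hl hd hψ hs, Finset.sum_mul]
  apply Finset.sum_congr rfl
  intro j _
  rw [MulChar.mul_apply, map_pow ω, ← MulChar.pow_apply' ω two_ne_zero, hω, chebChi_apply,
    chebChi_apply]
  ring

lemma chebChi_s0 (hF : ringChar F ≠ 2) {q : ℕ} (hodd : Odd q) (hQ : Fintype.card F = q ^ 2)
    {s : F} (s0 : s ≠ 0) (hs : s ^ q = -s) :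
    chebChi F s = (-1) ^ ((q + 1) / 2) := by
  have h1 := quadraticChar_eq_pow_of_char_ne_two' hF s
  obtain ⟨k, rfl⟩ := hodd
  have h2 : (2 * k + 1) ^ 2 / 2 = (2 * k) * (k + 1) := by
    have : (2 * k + 1) ^ 2 = 2 * ((2 * k) * (k + 1)) + 1 := by ring
    omega
  have h3 : s ^ (2 * k) = -1 := by
    have : s * s ^ (2 * k) = s * (-1) := by
      rw [← pow_succ', hs]; ring
    exact mul_left_cancel₀ s0 this
  have h4 : (2 * k + 1 + 1) / 2 = k + 1 := by omega
  rw [hQ, h2, pow_mul, h3] at h1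
  rw [h4, chebChi_apply]
  have hne := Ring.neg_one_ne_one_of_char_ne_two hF
  rcases Nat.even_or_odd (k + 1) with he | ho
  · rw [he.neg_one_pow] at h1 ⊢
    rcases quadraticChar_dichotomy s0 with h | h
    · simp [h]
    · rw [h] at h1; push_cast at h1; exact absurd h1 hne
  · rw [ho.neg_one_pow] at h1 ⊢
    rcases quadraticChar_dichotomy s0 with h | h
    · rw [h] at h1; push_cast at h1; exact absurd h1.symm hne
    · simp [h]

lemma cheb_odd_sq {q : ℕ} (hodd : Odd q) : 8 ∣ q ^ 2 - 1 := by
  obtain ⟨k, rfl⟩ := hodd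
  have h := Nat.even_mul_succ_self k
  obtain ⟨j, hj⟩ := h
  refine ⟨j, ?_⟩
  have : (2 * k + 1) ^ 2 = 4 * (k * (k + 1)) + 1 := by ring
  omega

/-- quartic character package -/
lemma cheb_exists_omega (hF : ringChar F ≠ 2) {q : ℕ} (hodd : Odd q)
    (hQ : Fintype.card F = q ^ 2) :
    ∃ ω : MulChar F ℂ, orderOf ω = 4 ∧ ω ^ 2 = chebChi F ∧ ω (-1) = 1 ∧ chebChi F (-1) = 1 := by
  have h8 : 8 ∣ Fintype.card F - 1 := by rw [hQ]; exact cheb_odd_sq hodd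
  obtain ⟨ω, hω⟩ := MulChar.exists_mulChar_orderOf F (n := 4) (dvd_trans (by norm_num) h8)
    (Complex.isPrimitiveRoot_exp 4 (by norm_num))
  have hω2 : ω ^ 2 = chebChi F := by
    apply cheb_quad_unique _ _ (chebChi_ne_one hF) chebChi_sq
    · intro h
      have := orderOf_dvd_of_pow_eq_one h
      rw [hω] at this
      omega
    · have h := pow_orderOf_eq_one ω; rw [hω] at h; rw [← pow_mul]; exact h
  have hm1 : IsSquare (-1 : F) := by
    rw [FiniteField.isSquare_neg_one_iff]
    have := Fintype.card_pos (α := F)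
    omega
  obtain ⟨i, hi⟩ := hm1
  have hi0 : i ≠ 0 := by rintro rfl; simp at hi
  have hχi : chebChi F i = 1 := by
    have h1 := quadraticChar_eq_pow_of_char_ne_two' hF i
    obtain ⟨m, hm⟩ := h8
    have hpos := Fintype.card_pos (α := F)
    have h2 : Fintype.card F / 2 = 2 * (2 * m) := by omega
    rw [h2, pow_mul, pow_two, ← hi, pow_mul] at h1
    rw [neg_one_sq, one_pow] at h1
    rw [chebChi_apply]
    rcases quadraticChar_dichotomy hi0 with h | h
    · simp [h]
    · rw [h] at h1; push_cast at h1
      exact absurd h1 (Ring.neg_one_ne_one_of_char_ne_two hF)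
  have hω1 : ω (-1) = 1 := by
    rw [hi, map_mul, ← pow_two, ← MulChar.pow_apply' ω two_ne_zero, hω2, hχi]
  refine ⟨ω, hω, hω2, hω1, ?_⟩
  rw [hi, map_mul, hχi, one_mul]

lemma cheb_J_pure {p n q : ℕ} [hp : Fact p.Prime] [CharP F p] (hp2 : p ≠ 2) (hn : 0 < n)
    (hqn : q = p ^ n) (hQ : Fintype.card F = q ^ 2)
    {ν : MulChar F ℂ} (hν : ν ≠ 1) (hνχ : ν * chebChi F ≠ 1) (hνq : ν ^ (q + 1) = 1) :
    jacobiSum ν (chebChi F) = q := by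
  have hF : ringChar F ≠ 2 := by rw [ringChar.eq F p]; exact hp2
  have hodd : Odd q := by rw [hqn]; exact (hp.out.odd_of_ne_two hp2).pow
  have hq : 1 < q := by rw [hqn]; exact Nat.one_lt_pow hn.ne' hp.out.one_lt
  obtain ⟨e, hprim, he⟩ := cheb_exists_addChar (F := F) p
  obtain ⟨s, s0, hs⟩ := cheb_exists_s0 hq hodd hQ
  have hχq : chebChi F ^ (q + 1) = 1 := by
    obtain ⟨k, rfl⟩ := hodd
    rw [show 2 * k + 1 + 1 = 2 * (k + 1) by ring, pow_mul, chebChi_sq, one_pow]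
  have h := jacobiSum_mul_nontrivial hνχ e
  rw [cheb_gauss_pure hp2 hn hqn hQ hprim he s0 hs hν hνq,
    cheb_gauss_pure hp2 hn hqn hQ hprim he s0 hs (chebChi_ne_one hF) hχq,
    cheb_gauss_pure hp2 hn hqn hQ hprim he s0 hs hνχ (by rw [mul_pow, hνq, hχq, one_mul]),
    MulChar.mul_apply] at h
  have hq0 : (q : ℂ) ≠ 0 := by exact_mod_cast (by omega : q ≠ 0)
  have h1 : ν s ≠ 0 := MulChar.apply_ne_zero_iff.2 s0.isUnit
  have h2 : chebChi F s ≠ 0 := MulChar.apply_ne_zero_iff.2 s0.isUnit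
  have h3 : (q : ℂ) * (ν s * chebChi F s) ≠ 0 := mul_ne_zero hq0 (mul_ne_zero h1 h2)
  apply mul_left_cancel₀ h3
  rw [h]; ring

lemma cheb_J_frob {p n q : ℕ} [hp : Fact p.Prime] [CharP F p] (hp2 : p ≠ 2) (hn : 0 < n)
    (hqn : q = p ^ n) (hQ : Fintype.card F = q ^ 2)
    {ν : MulChar F ℂ} (hνχ : ν * chebChi F ≠ 1) {k : ℕ} (hνk : ν ^ p ^ k = ν * chebChi F) :
    jacobiSum ν (chebChi F) = (-1) ^ ((q + 1) / 2) * q := by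
  have hF : ringChar F ≠ 2 := by rw [ringChar.eq F p]; exact hp2
  have hodd : Odd q := by rw [hqn]; exact (hp.out.odd_of_ne_two hp2).pow
  have hq : 1 < q := by rw [hqn]; exact Nat.one_lt_pow hn.ne' hp.out.one_lt
  obtain ⟨e, hprim, he⟩ := cheb_exists_addChar (F := F) p
  obtain ⟨s, s0, hs⟩ := cheb_exists_s0 hq hodd hQ
  have hχq : chebChi F ^ (q + 1) = 1 := by
    obtain ⟨k, rfl⟩ := hodd
    rw [show 2 * k + 1 + 1 = 2 * (k + 1) by ring, pow_mul, chebChi_sq, one_pow]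
  have h := jacobiSum_mul_nontrivial hνχ e
  have hne : gaussSum (ν * chebChi F) e ≠ 0 := by
    apply gaussSum_ne_zero_of_nontrivial _ hνχ hprim
    exact_mod_cast Fintype.card_ne_zero
  have hfr := cheb_gauss_frob he k ν
  rw [hνk] at hfr
  rw [← hfr, cheb_gauss_pure hp2 hn hqn hQ hprim he s0 hs (chebChi_ne_one hF) hχq,
    chebChi_s0 hF hodd hQ s0 hs] at h
  rw [mul_left_cancel₀ hne h, mul_comm]

lemma chebT_odd {p n q l : ℕ} [hp : Fact p.Prime] [CharP F p] (hp2 : p ≠ 2) (hn : 0 < n)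
    (hqn : q = p ^ n) (hQ : Fintype.card F = q ^ 2) (hq4 : q % 4 = 3) (hl : Odd l)
    (hlq : l ∣ q + 1 ∨ l ∣ q - 1) : chebT F l = 2 * l * q := by
  have hF : ringChar F ≠ 2 := by rw [ringChar.eq F p]; exact hp2
  have hodd : Odd q := by rw [hqn]; exact (hp.out.odd_of_ne_two hp2).pow
  have hq : 1 < q := by rw [hqn]; exact Nat.one_lt_pow hn.ne' hp.out.one_lt
  obtain ⟨ω, hω, hω2, hω1, hχ1⟩ := cheb_exists_omega hF hodd hQ
  have hd : l ∣ Fintype.card F - 1 := by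
    have : q ^ 2 - 1 = (q + 1) * (q - 1) := by
      have := Nat.sq_sub_sq q 1
      simpa using this
    rw [hQ, this]
    rcases hlq with h | h
    · exact h.mul_right _
    · exact h.mul_left _
  obtain ⟨ψ, hψ⟩ := MulChar.exists_mulChar_orderOf F (n := l) hd
    (Complex.isPrimitiveRoot_exp l hl.pos.ne')
  have hψl : ψ ^ l = 1 := by rw [← hψ, pow_orderOf_eq_one]
  have hω4 : ω ^ 4 = 1 := by rw [← hω, pow_orderOf_eq_one]
  have hne : ∀ j a : ℕ, Odd a → ψ ^ j * ω ^ a ≠ 1 := by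
    intro j a ha h
    have h1 : (ψ ^ j * ω ^ a) ^ l = 1 := by rw [h, one_pow]
    rw [mul_pow, ← pow_mul, mul_comm j, pow_mul, hψl, one_pow, one_mul, ← pow_mul] at h1
    have h2 := orderOf_dvd_of_pow_eq_one h1
    rw [hω] at h2
    have h3 : Odd (a * l) := ha.mul hl
    obtain ⟨c, hc⟩ := h2
    rw [hc] at h3
    have : Even (4 * c) := ⟨2 * c, by ring⟩
    exact (Nat.not_odd_iff_even.2 this) h3
  have hJ : ∀ j a : ℕ, Odd a → jacobiSum (ψ ^ j * ω ^ a) (chebChi F) = q := by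
    intro j a ha
    have hχ : ψ ^ j * ω ^ a * chebChi F = ψ ^ j * ω ^ (a + 2) := by
      rw [← hω2, mul_assoc, ← pow_add]
    have hne2 : ψ ^ j * ω ^ a * chebChi F ≠ 1 := by
      rw [hχ]; exact hne j _ (by simpa [parity_simps] using ha)
    rcases hlq with h | h
    · apply cheb_J_pure hp2 hn hqn hQ (hne j a ha) hne2
      obtain ⟨c, hc⟩ := h
      obtain ⟨d, hd⟩ : 4 ∣ q + 1 := by omega
      rw [mul_pow]
      nth_rewrite 1 [hc]
      rw [hd, ← pow_mul, ← pow_mul, show j * (l * c) = l * (j * c) by ring,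
        show a * (4 * d) = 4 * (a * d) by ring, pow_mul, pow_mul ω, hψl, hω4, one_pow, one_pow,
        one_mul]
    · rw [cheb_J_frob hp2 hn hqn hQ hne2 (k := n)]
      · have : Even ((q + 1) / 2) := by rw [Nat.even_iff]; omega
        rw [this.neg_one_pow, one_mul]
      · rw [hχ, ← hqn, mul_pow]
        obtain ⟨c, hc⟩ := h
        have hc' : q = l * c + 1 := by omega
        have e1 : (ψ ^ j) ^ q = ψ ^ j := by
          rw [← pow_mul]
          nth_rewrite 1 [hc']
          rw [show j * (l * c + 1) = l * (j * c) + j by ring, pow_add, pow_mul, hψl, one_pow,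
            one_mul]
        have e2 : (ω ^ a) ^ q = ω ^ (a + 2) := by
          obtain ⟨d, hd⟩ : ∃ d, q = 4 * d + 3 := ⟨q / 4, by omega⟩
          obtain ⟨b, rfl⟩ := ha
          rw [← pow_mul, hd, show (2 * b + 1) * (4 * d + 3) = 4 * (d * (2 * b + 1) + b) + (2 * b + 1 + 2)
            by ring, pow_add, pow_mul, hω4, one_pow, one_mul]
        rw [e1, e2]
  have hform := chebT_formula hF hl hd hψ hω2 hω1 hχ1
  rw [Finset.sum_congr rfl (g := fun _ => (2 * q : ℂ))] at hform
  · rw [Finset.sum_const, card_range, nsmul_eq_mul] at hform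
    have : (chebT F l : ℂ) = ((2 * l * q : ℤ) : ℂ) := by
      rw [hform]; push_cast; ring
    exact_mod_cast this
  · intro j _
    have h1 := hJ j 1 odd_one
    have h2 := hJ j 3 (by decide)
    rw [pow_one] at h1
    rw [h1, mul_assoc, ← hω2, ← pow_succ', hω2, h2]
    ring

lemma chebT_one_even {p n q : ℕ} [hp : Fact p.Prime] [CharP F p] (hp4 : p % 4 = 3) (hn : 0 < n)
    (hqn : q = p ^ n) (hQ : Fintype.card F = q ^ 2) (hq4 : q % 4 = 1) :
    chebT F 1 = -2 * q := by
  have hp2 : p ≠ 2 := by rintro rfl; omega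
  have hF : ringChar F ≠ 2 := by rw [ringChar.eq F p]; exact hp2
  have hodd : Odd q := by rw [hqn]; exact (hp.out.odd_of_ne_two hp2).pow
  obtain ⟨ω, hω, hω2, hω1, hχ1⟩ := cheb_exists_omega hF hodd hQ
  have hω4 : ω ^ 4 = 1 := by rw [← hω, pow_orderOf_eq_one]
  have hform := chebT_formula hF odd_one (one_dvd _) (ψ := 1) orderOf_one hω2 hω1 hχ1
  simp only [range_one, sum_singleton, pow_zero, one_mul] at hform
  obtain ⟨d, hd⟩ : ∃ d, p = 4 * d + 3 := ⟨p / 4, by omega⟩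
  have hne : ω ≠ 1 := by
    rintro rfl; simp at hω
  have h3 : ω * chebChi F = ω ^ 3 := by rw [← hω2]; exact (pow_succ' ω 2).symm
  have h3' : ω * chebChi F * chebChi F = ω := by
    rw [mul_assoc, ← pow_two, chebChi_sq, mul_one]
  have hne3 : ω * chebChi F ≠ 1 := by
    rw [h3]
    intro h
    have := orderOf_dvd_of_pow_eq_one h
    rw [hω] at this
    omega
  have hp1 : ω ^ p ^ 1 = ω * chebChi F := by
    rw [pow_one, h3, hd, pow_add, pow_mul, hω4, one_pow, one_mul]
  have hp3 : (ω * chebChi F) ^ p ^ 1 = ω * chebChi F * chebChi F := by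
    rw [h3', h3, pow_one, ← pow_mul, hd, show 3 * (4 * d + 3) = 4 * (3 * d + 2) + 1 by ring,
      pow_add, pow_mul, hω4, one_pow, one_mul, pow_one]
  have hs : Odd ((q + 1) / 2) := by rw [Nat.odd_iff]; omega
  rw [cheb_J_frob hp2 hn hqn hQ hne3 hp1,
    cheb_J_frob hp2 hn hqn hQ (by rw [h3']; exact hne) hp3, hs.neg_one_pow] at hform
  have : (chebT F 1 : ℂ) = ((-2 * q : ℤ) : ℂ) := by
    rw [hform]; push_cast; ring
  exact_mod_cast this

end part3

lemma cheb_m_odd (l : ℕ) (hl : l.Prime) (hl4 : l % 4 = 3) (u : (ZMod l)ˣ) :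
    Odd (orderOf (QuotientGroup.mk u : (ZMod l)ˣ ⧸ Subgroup.zpowers (-1 : (ZMod l)ˣ))) := by
  haveI : Fact l.Prime := ⟨hl⟩
  have h1 : (QuotientGroup.mk u : (ZMod l)ˣ ⧸ Subgroup.zpowers (-1 : (ZMod l)ˣ)) ^ (l / 2) = 1 := by
    rw [← QuotientGroup.mk_pow, QuotientGroup.eq_one_iff]
    have h := ZMod.pow_div_two_eq_neg_one_or_one l (a := (u : ZMod l)) u.ne_zero
    rcases h with h | h
    · have : u ^ (l / 2) = 1 := by ext; simpa using h
      rw [this]; exact one_mem _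
    · have : u ^ (l / 2) = -1 := by ext; simpa using h
      rw [this]; exact Subgroup.mem_zpowers _
  have h2 := orderOf_dvd_of_pow_eq_one h1
  have h3 : Odd (l / 2) := by rw [Nat.odd_iff]; omega
  exact Odd.of_dvd_nat h3 h2

lemma cheb_m_dvd (l p : ℕ) (hl : l.Prime) (hp : p.Prime) (u : (ZMod l)ˣ)
    (hu : (u : ZMod l) = (p : ZMod l)) (n : ℕ) :
    orderOf (QuotientGroup.mk u : (ZMod l)ˣ ⧸ Subgroup.zpowers (-1 : (ZMod l)ˣ)) ∣ n ↔
      (l ∣ p ^ n + 1 ∨ l ∣ p ^ n - 1) := by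
  haveI : Fact l.Prime := ⟨hl⟩
  rw [orderOf_dvd_iff_pow_eq_one, ← QuotientGroup.mk_pow, QuotientGroup.eq_one_iff]
  have hpos : 1 ≤ p ^ n := Nat.one_le_pow _ _ hp.pos
  have e1 : l ∣ p ^ n + 1 ↔ u ^ n = -1 := by
    rw [← ZMod.natCast_eq_zero_iff, Units.ext_iff]
    push_cast
    rw [hu, eq_neg_iff_add_eq_zero]
  have e2 : l ∣ p ^ n - 1 ↔ u ^ n = 1 := by
    rw [← ZMod.natCast_eq_zero_iff, Units.ext_iff, Nat.cast_sub hpos]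
    push_cast
    rw [hu, sub_eq_zero]
  rw [e1, e2]
  constructor
  · intro h
    obtain ⟨k, hk⟩ := Subgroup.mem_zpowers_iff.1 h
    rcases Int.even_or_odd k with h | h
    · right; rw [← hk, h.neg_one_zpow]
    · left; rw [← hk, h.neg_one_zpow]
  · rintro (h | h)
    · rw [h]; exact Subgroup.mem_zpowers _
    · rw [h]; exact one_mem _

lemma cheb_coprime (l q : ℕ) (hl : l.Prime) (hl4 : l % 4 = 3) (hq : 1 ≤ q)
    (h : ¬ (l ∣ q + 1 ∨ l ∣ q - 1)) : Nat.Coprime l ((q ^ 2) ^ 2 - 1) := by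
  haveI : Fact l.Prime := ⟨hl⟩
  rw [hl.coprime_iff_not_dvd]
  intro hd
  apply h
  have hpos : 1 ≤ (q ^ 2) ^ 2 := Nat.one_le_pow _ _ (by positivity)
  rw [← ZMod.natCast_eq_zero_iff, Nat.cast_sub hpos] at hd
  rw [← ZMod.natCast_eq_zero_iff, ← ZMod.natCast_eq_zero_iff, Nat.cast_sub hq]
  push_cast at hd ⊢
  have h1 : ((q : ZMod l) ^ 2 + 1) * (((q : ZMod l) + 1) * (q - 1)) = 0 := by
    rw [← hd]; ring
  rcases mul_eq_zero.1 h1 with h2 | h2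
  · exfalso
    have : IsSquare (-1 : ZMod l) := ⟨(q : ZMod l), by linear_combination -h2⟩
    rw [ZMod.exists_sq_eq_neg_one_iff] at this
    omega
  · exact mul_eq_zero.1 h2

lemma cheb_coprime' (l q : ℕ) (hl : l.Prime) (hl4 : l % 4 = 3) (hq : 1 ≤ q)
    (h : l ∣ q + 1 ∨ l ∣ q - 1) : Nat.Coprime l (q ^ 2 + 1) ∧ l ∣ q ^ 2 - 1 := by
  have h1 : l ∣ q ^ 2 - 1 := by
    have : q ^ 2 - 1 = (q + 1) * (q - 1) := by
      have := Nat.sq_sub_sq q 1; simpa using this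
    rw [this]
    rcases h with h | h
    · exact h.mul_right _
    · exact h.mul_left _
  refine ⟨?_, h1⟩
  rw [hl.coprime_iff_not_dvd]
  intro h2
  have h3 := Nat.dvd_sub h2 h1
  have hq2 : 1 ≤ q ^ 2 := Nat.one_le_pow _ _ hq
  have h4 : q ^ 2 + 1 - (q ^ 2 - 1) = 2 := by omega
  rw [h4] at h3
  have := Nat.le_of_dvd (by norm_num) h3
  omega

theorem statement1 (l p : ℕ) (hl : l.Prime) (hl4 : l % 4 = 3)
    (hp : p.Prime) (hp4 : p % 4 = 3) (hne : p ≠ l)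
    (u : (ZMod l)ˣ) (hu : (u : ZMod l) = (p : ZMod l)) (m : ℕ)
    (hm : m = orderOf (QuotientGroup.mk u :
      (ZMod l)ˣ ⧸ Subgroup.zpowers (-1 : (ZMod l)ˣ)))
    (n : ℕ) (hn : 0 < n) :
    chebMaximal l (p ^ n) ↔ ∃ k, Odd k ∧ 0 < k ∧ n = k * m := by
  classical
  haveI : Fact p.Prime := ⟨hp⟩
  have hmo := cheb_m_odd l hl hl4 u
  have hmd := cheb_m_dvd l p hl hp u hu n
  rw [← hm] at hmo hmd
  have hp2 : p ≠ 2 := by rintro rfl; omega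
  have hlo : Odd l := by rw [Nat.odd_iff]; omega
  have hl1 : 1 ≤ l := hl.one_le
  set q := p ^ n with hqn
  have hq1 : 1 ≤ q := Nat.one_le_pow _ _ hp.pos
  have rhs : (∃ k, Odd k ∧ 0 < k ∧ n = k * m) ↔ (l ∣ q + 1 ∨ l ∣ q - 1) ∧ Odd n := by
    rw [← hmd]
    constructor
    · rintro ⟨k, hk, -, h⟩
      exact ⟨⟨k, by rw [h, mul_comm]⟩, by rw [h]; exact hk.mul hmo⟩
    · rintro ⟨⟨k, hk⟩, ho⟩
      have hko : Odd k := by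
        rw [hk] at ho
        exact (Nat.odd_mul.1 ho).2
      exact ⟨k, hko, hko.pos, by rw [hk, mul_comm]⟩
  rw [rhs]
  have hchar : ∀ (F : Type) [Field F] [Fintype F], Fintype.card F = q ^ 2 → CharP F p := by
    intro F _ _ hc
    refine charP_of_card_eq_prime_pow (f := n * 2) ?_
    rw [hc, hqn, pow_mul]
  have hring : ∀ (F : Type) [Field F] [CharP F p], ringChar F ≠ 2 := by
    intro F _ _
    rw [ringChar.eq F p]; exact hp2
  have hcast : ((q ^ 2 + (l - 1) * q : ℕ) : ℤ) = (q : ℤ) ^ 2 + ((l : ℤ) - 1) * q := by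
    rw [Nat.cast_add, Nat.cast_mul, Nat.cast_sub hl1]; push_cast; ring
  constructor
  · intro hmax
    have hex : ∃ (F : Type) (_ : Field F) (_ : Fintype F), Fintype.card F = q ^ 2 := by
      letI : Fintype (GaloisField p (n * 2)) := Fintype.ofFinite _
      refine ⟨GaloisField p (n * 2), inferInstance, inferInstance, ?_⟩
      rw [← Nat.card_eq_fintype_card, GaloisField.card p (n * 2) (by omega), hqn, pow_mul]
    obtain ⟨F, _, _, hc⟩ := hex
    have hM := hmax F hc
    haveI := hchar F hc
    have h4 := cheb_count (F := F) (hring F) l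
    rw [hM, hcast, hc] at h4
    push_cast at h4
    have hqz : (0 : ℤ) < q := by exact_mod_cast hq1
    have hlz : (3 : ℤ) ≤ l := by
      have : 3 ≤ l := by omega
      exact_mod_cast this
    have hd : l ∣ q + 1 ∨ l ∣ q - 1 := by
      by_contra hd
      have h5 := cheb_sum_perm (F := F) (l := l) (hring F)
        (by rw [hc]; exact cheb_coprime l q hl hl4 hq1 hd)
      rw [h5] at h4
      have : (0 : ℤ) < ((l : ℤ) - 1) * q := mul_pos (by linarith) hqz
      linarith
    refine ⟨hd, ?_⟩
    by_contra ho
    rw [Nat.not_odd_iff_even] at ho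
    have hq4 : q % 4 = 1 := by
      obtain ⟨k, rfl⟩ := ho
      rw [hqn, ← two_mul, pow_mul, Nat.pow_mod, Nat.pow_mod p, hp4]
      norm_num
    obtain ⟨hcop, hdv⟩ := cheb_coprime' l q hl hl4 hq1 hd
    have h2 := chebT_one_even (F := F) hp4 hn hqn hc hq4
    have h3 := cheb_two_S (F := F) (hring F) hlo (by rw [hc]; exact hcop)
    have h1 := chebT_dvd (F := F) hlo (by rw [hc]; exact hdv)
    have h6 : chebT F l = (l : ℤ) * (2 * q) - ((4 * q : ℕ) : ℤ) := by
      push_cast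
      linarith
    rw [h6] at h1
    have h7 : (l : ℤ) ∣ ((4 * q : ℕ) : ℤ) := by
      have := dvd_sub (dvd_mul_right (l : ℤ) (2 * q)) h1
      simpa only [sub_sub_cancel] using this
    have h8 : l ∣ 4 * q := by exact_mod_cast h7
    rcases (hl.dvd_mul).1 h8 with h | h
    · have := (Nat.prime_dvd_prime_iff_eq hl Nat.prime_two).1
        (hl.dvd_of_dvd_pow (show l ∣ 2 ^ 2 by simpa using h))
      omega
    · exact hne ((Nat.prime_dvd_prime_iff_eq hl hp).1 (hl.dvd_of_dvd_pow h)).symm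
  · rintro ⟨hd, ho⟩ F _ _ hc
    haveI := hchar F hc
    have hq4 : q % 4 = 3 := by
      obtain ⟨k, rfl⟩ := ho
      rw [hqn, pow_succ, pow_mul, Nat.mul_mod, Nat.pow_mod, Nat.pow_mod p, hp4]
      norm_num
    obtain ⟨hcop, hdv⟩ := cheb_coprime' l q hl hl4 hq1 hd
    have h1 := chebT_odd (F := F) hp2 hn hqn hc hq4 hlo hd
    have h2 := chebT_odd (F := F) (l := 1) hp2 hn hqn hc hq4 odd_one (Or.inl (one_dvd _))
    have h3 := cheb_two_S (F := F) (hring F) hlo (by rw [hc]; exact hcop)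
    have h4 := cheb_count (F := F) (hring F) l
    rw [hc] at h4
    rw [h1, h2] at h3
    zify
    rw [h4]
    zify at hcast
    push_cast at h3 h4 ⊢
    rw [Nat.cast_sub hl1]
    push_cast
    linarith
end
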